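/- arXiv:1512.06946 — 2 statements merged into one kernel-verified Lean document; each statement's English description precedes it below -/
import Mathlib

section
/- There are exactly 162 totally ramified extensions of Q_3 of degree 9 with discriminant (3)^{15} inside a fixed algebraic closure of Q_3. -/
open Polynomial

/-- An additive valuation `v` (written additively, with `v 0 = ⊤`) on a field `Ω`,
extending the `p`-adic valuation of `ℚ_[p]` (scaled by the ramification index `e`),
taking integer values on an intermediate field `K` and normalized so that a
uniformizer `unif` of `K` has valuation `1`. -/
structure PadicSetup (p : ℕ) [Fact p.Prime] (K Ω : Type*) [Field K] [Field Ω]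
    [Algebra ℚ_[p] K] [Algebra ℚ_[p] Ω] [Algebra K Ω] [IsScalarTower ℚ_[p] K Ω] where
  v : Ω → WithTop ℚ
  v_top_iff : ∀ x : Ω, v x = ⊤ ↔ x = 0
  v_mul : ∀ x y : Ω, v (x * y) = v x + v y
  v_add : ∀ x y : Ω, min (v x) (v y) ≤ v (x + y)
  e : ℕ
  e_pos : 0 < e
  v_padic : ∀ x : ℚ_[p], x ≠ 0 →
    v (algebraMap ℚ_[p] Ω x) = (((e : ℤ) * x.valuation : ℤ) : ℚ)
  v_int : ∀ x : K, x ≠ 0 → ∃ m : ℤ, v (algebraMap K Ω x) = ((m : ℚ) : WithTop ℚ)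
  unif : K
  v_unif : v (algebraMap K Ω unif) = 1

variable {p : ℕ} [Fact p.Prime] {K Ω : Type*} [Field K] [Field Ω]
    [Algebra ℚ_[p] K] [Algebra ℚ_[p] Ω] [Algebra K Ω] [IsScalarTower ℚ_[p] K Ω]

/-- `f` is an Eisenstein polynomial of degree `n` over `K` (with respect to the
normalized valuation of `K`): monic of degree `n`, all lower coefficients have
valuation at least `1`, and the constant coefficient has valuation exactly `1`. -/
def PadicSetup.IsEisensteinOfDegree (S : PadicSetup p K Ω) (f : K[X]) (n : ℕ) : Prop :=
  f.Monic ∧ f.natDegree = n ∧ (∀ i < n, 1 ≤ S.v (algebraMap K Ω (f.coeff i))) ∧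
    S.v (algebraMap K Ω (f.coeff 0)) = 1

/-- The `i`-th coefficient of the ramification polynomial `ρ(x) = f(αx+α)/αⁿ` of `f`,
namely `ρ_i = ∑_{k=i}^n C(k,i) f_k α^{k-n}`. -/
noncomputable def PadicSetup.rho (S : PadicSetup p K Ω) (f : K[X]) (n : ℕ) (α : Ω)
    (i : ℕ) : Ω :=
  ∑ k ∈ Finset.Icc i n, (k.choose i : Ω) * algebraMap K Ω (f.coeff k) * α ^ ((k : ℤ) - (n : ℤ))

/-- The additive valuation underlying a `PadicSetup`. -/
noncomputable def PadicSetup.addValuation (S : PadicSetup p K Ω) :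
    AddValuation Ω (WithTop ℚ) :=
  AddValuation.of S.v ((S.v_top_iff 0).2 rfl)
    (by
      have h := S.v_mul 1 1
      rw [mul_one] at h
      have h1 : S.v 1 ≠ ⊤ := fun h0 => one_ne_zero ((S.v_top_iff 1).1 h0)
      lift S.v 1 to ℚ using h1 with q
      norm_cast at h ⊢
      linarith)
    S.v_add S.v_mul

/-- The additive valuation `w` extends the `p`-adic valuation of `ℚ_[p]`. -/
def AddValuation.ExtendsPadic (p : ℕ) [Fact p.Prime] {Ω : Type*} [Field Ω] [Algebra ℚ_[p] Ω]
    (w : AddValuation Ω (WithTop ℚ)) : Prop :=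
  ∀ x : ℚ_[p], x ≠ 0 → w (algebraMap ℚ_[p] Ω x) = ((x.valuation : ℚ) : WithTop ℚ)

theorem PadicSetup.extendsPadic_addValuation (S : PadicSetup p ℚ_[p] Ω) :
    S.addValuation.ExtendsPadic p := by
  intro x hx
  have hu : S.unif ≠ 0 := fun h => by
    have := S.v_unif
    rw [h, map_zero, (S.v_top_iff 0).2 rfl] at this
    exact WithTop.top_ne_one this
  have he : S.e = 1 := by
    have h := S.v_padic S.unif hu
    rw [S.v_unif] at h
    have h1 : (1 : ℤ) = S.e * S.unif.valuation := by exact_mod_cast h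
    have h2 : (S.e : ℤ) ∣ 1 := ⟨_, h1⟩
    exact_mod_cast Int.eq_one_of_dvd_one (by positivity) h2
  change S.v _ = _
  rw [S.v_padic x hx, he]
  simp

namespace AddValuation

section General

variable {F : Type*} [Field F] (w : AddValuation F (WithTop ℚ))

theorem map_sum_eq_inf {ι : Type*} (s : Finset ι) (f : ι → F)
    (h : ∀ i ∈ s, ∀ j ∈ s, w (f i) = w (f j) → w (f i) ≠ ⊤ → i = j) :
    w (∑ i ∈ s, f i) = s.inf fun i => w (f i) := by
  classical
  refine le_antisymm ?_ (w.map_le_sum fun i hi => Finset.inf_le hi)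
  rcases s.eq_empty_or_nonempty with rfl | hs
  · simp
  obtain ⟨i, hi, hinf⟩ := s.exists_mem_eq_inf hs fun i => w (f i)
  by_cases htop : w (f i) = ⊤
  · rw [hinf, htop]
    exact le_top
  have hlt : w (f i) < w (∑ j ∈ s.erase i, f j) := by
    refine w.map_lt_sum htop fun j hj => ?_
    have hj' := Finset.mem_erase.1 hj
    refine lt_of_le_of_ne (hinf ▸ Finset.inf_le hj'.2) fun he => hj'.1 ?_
    exact (h i hi j hj'.2 he htop).symm
  rw [hinf, ← Finset.add_sum_erase s f hi, w.map_add_eq_of_lt_left hlt]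

theorem map_prod_eq_sum {ι : Type*} (s : Finset ι) (f : ι → F) :
    w (∏ i ∈ s, f i) = ∑ i ∈ s, w (f i) := by
  classical
  induction s using Finset.induction_on with
  | empty => simp
  | insert a s ha ih => rw [Finset.prod_insert ha, Finset.sum_insert ha, w.map_mul, ih]

theorem map_pow_of_eq {α : F} {q : ℚ} (h : w α = (q : WithTop ℚ)) (i : ℕ) :
    w (α ^ i) = ((i * q : ℚ) : WithTop ℚ) := by
  rw [w.map_pow, h, ← WithTop.coe_nsmul, nsmul_eq_mul]

end General

section Padic

variable {w : AddValuation Ω (WithTop ℚ)} (hw : w.ExtendsPadic p)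

/-- The function `q ↦ p ^ (-q)` on `WithTop ℚ`, with value `0` at `⊤`. -/
noncomputable def powNeg (p : ℕ) (a : WithTop ℚ) : ℝ :=
  WithTop.recTopCoe (C := fun _ => ℝ) 0 (fun q : ℚ => (p : ℝ) ^ (-(q : ℝ))) a

theorem powNeg_top (p : ℕ) : powNeg p ⊤ = 0 := rfl

theorem powNeg_coe (p : ℕ) (q : ℚ) : powNeg p (q : WithTop ℚ) = (p : ℝ) ^ (-(q : ℝ)) := rfl

theorem powNeg_nonneg (p : ℕ) (a : WithTop ℚ) : 0 ≤ powNeg p a := by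
  induction a with
  | top => exact le_rfl
  | coe a => exact Real.rpow_nonneg (by positivity) _

theorem powNeg_lt_powNeg (p : ℕ) [hp : Fact p.Prime] {a b : WithTop ℚ} (h : a < b) :
    powNeg p b < powNeg p a := by
  have hp1 : (1 : ℝ) < p := by exact_mod_cast hp.out.one_lt
  induction a with
  | top => simp at h
  | coe a =>
    rw [powNeg_coe]
    induction b with
    | top => exact Real.rpow_pos_of_pos (by linarith) _
    | coe b =>
      rw [powNeg_coe]
      exact Real.rpow_lt_rpow_of_exponent_lt hp1 (by simpa using h)

theorem powNeg_add (p : ℕ) [hp : Fact p.Prime] (a b : WithTop ℚ) :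
    powNeg p (a + b) = powNeg p a * powNeg p b := by
  have hp0 : (0 : ℝ) < p := by exact_mod_cast hp.out.pos
  induction a with
  | top => simp [powNeg_top]
  | coe a =>
    induction b with
    | top => simp [powNeg_top]
    | coe b =>
      rw [← WithTop.coe_add, powNeg_coe, powNeg_coe, powNeg_coe, ← Real.rpow_add hp0]
      push_cast
      ring_nf

/-- The absolute value `x ↦ p ^ (-w x)` attached to an additive valuation `w`. -/
noncomputable def realAbs (p : ℕ) [hp : Fact p.Prime] {F : Type*} [Field F]
    (w : AddValuation F (WithTop ℚ)) : AbsoluteValue F ℝ where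
  toFun x := powNeg p (w x)
  map_mul' x y := by rw [w.map_mul, powNeg_add]
  nonneg' x := powNeg_nonneg _ _
  eq_zero' x := by
    rw [← w.top_iff]
    refine ⟨fun h => ?_, fun h => by rw [h, powNeg_top]⟩
    by_contra hne
    have := powNeg_lt_powNeg p (lt_top_iff_ne_top.2 hne)
    rw [h, powNeg_top] at this
    exact lt_irrefl _ this
  add_le' x y := by
    have hanti : Antitone (powNeg p) :=
      (show StrictAnti (powNeg p) from fun _ _ h => powNeg_lt_powNeg p h).antitone
    rcases w.map_add' x y with h | h
    · linarith [hanti h, powNeg_nonneg p (w y)]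
    · linarith [hanti h, powNeg_nonneg p (w x)]

include hw

theorem realAbs_algebraMap (x : ℚ_[p]) : w.realAbs p (algebraMap ℚ_[p] Ω x) = ‖x‖ := by
  rcases eq_or_ne x 0 with rfl | hx
  · simp
  change powNeg p (w (algebraMap ℚ_[p] Ω x)) = _
  rw [hw x hx, powNeg_coe, Padic.norm_eq_zpow_neg_valuation hx, ← Real.rpow_intCast]
  push_cast
  rfl

/-- Krasner's lemma. -/
theorem mem_adjoin_of_forall_lt [IsAlgClosed Ω] [Algebra.IsAlgebraic ℚ_[p] Ω] {x y : Ω}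
    (h : ∀ x', aeval x' (minpoly ℚ_[p] x) = 0 → x' ≠ x → w (x - x') < w (x - y)) :
    x ∈ IntermediateField.adjoin ℚ_[p] {y} := by
  have hint : ∀ z : Ω, IsIntegral ℚ_[p] z := fun z => Algebra.IsIntegral.isIntegral z
  let : NormedField Ω := (w.realAbs p).toNormedField
  let : NormedAlgebra ℚ_[p] Ω :=
    { ‹Algebra ℚ_[p] Ω› with
      norm_smul_le := fun r z => by
        rw [Algebra.smul_def, norm_mul]
        exact (congrArg (· * _) (realAbs_algebraMap hw r)).le }
  refine IsKrasner.krasner (K := ℚ_[p]) (L := Ω)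
    (minpoly.irreducible (hint x)).separable (IsAlgClosed.splits _) (hint y) fun x' hx' hne => ?_
  refine powNeg_lt_powNeg p (h x' ?_ hne.symm)
  rw [isConjRoot_def] at hx'
  rw [hx']
  exact minpoly.aeval _ _

theorem map_algebraMap_eq_top_or_int (x : ℚ_[p]) :
    w (algebraMap ℚ_[p] Ω x) = ⊤ ∨
      ∃ m : ℤ, w (algebraMap ℚ_[p] Ω x) = ((m : ℚ) : WithTop ℚ) := by
  rcases eq_or_ne x 0 with rfl | hx
  · exact Or.inl (by simp)
  · exact Or.inr ⟨_, hw x hx⟩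

/-- The valuation of `x` is at least `l`, with equality if `u` holds. -/
def IsBounded (w : AddValuation Ω (WithTop ℚ)) (l : ℕ) (u : Prop) (x : ℚ_[p]) : Prop :=
  ((l : ℚ) : WithTop ℚ) ≤ w (algebraMap ℚ_[p] Ω x) ∧
    (u → ¬ (((l + 1 : ℕ) : ℚ) : WithTop ℚ) ≤ w (algebraMap ℚ_[p] Ω x))

section Uniformizer

variable {n : ℕ} {α : Ω} (hα : w α = ((1 / n : ℚ) : WithTop ℚ))

include hα

theorem map_aeval_eq_inf {g : ℚ_[p][X]} (hg : g.natDegree < n) :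
    w (aeval α g) = (Finset.range n).inf fun i =>
      w (algebraMap ℚ_[p] Ω (g.coeff i)) + ((i / n : ℚ) : WithTop ℚ) := by
  have hn : (0 : ℚ) < n := by exact_mod_cast (Nat.zero_le _).trans_lt hg
  have hterm : ∀ i, w (algebraMap ℚ_[p] Ω (g.coeff i) * α ^ i) =
      w (algebraMap ℚ_[p] Ω (g.coeff i)) + ((i / n : ℚ) : WithTop ℚ) := fun i => by
    rw [w.map_mul, w.map_pow_of_eq hα, mul_one_div]
  simp only [aeval_eq_sum_range' hg, Algebra.smul_def]
  rw [w.map_sum_eq_inf]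
  · simp only [hterm]
  intro i hi j hj h htop
  simp only [hterm] at h htop
  obtain hi' | ⟨a, ha⟩ := map_algebraMap_eq_top_or_int hw (g.coeff i)
  · simp [hi'] at htop
  obtain hj' | ⟨b, hb⟩ := map_algebraMap_eq_top_or_int hw (g.coeff j)
  · simp [ha, hj', ← WithTop.coe_add] at h
  rw [ha, hb] at h
  have h1 : (a + i / n : ℚ) = b + j / n := by exact_mod_cast h
  field_simp at h1
  have h2 : n * (a - b) = (j : ℤ) - i := by
    have : (n * (a - b) : ℚ) = j - i := by linarith
    exact_mod_cast this
  have hi := Finset.mem_range.1 hi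
  have hj := Finset.mem_range.1 hj
  have h3 : (n : ℤ) ∣ (j : ℤ) - i := ⟨_, h2.symm⟩
  have h4 := Int.eq_zero_of_abs_lt_dvd h3 (by rw [abs_lt]; omega)
  omega

theorem le_map_aeval_iff {g : ℚ_[p][X]} (hg : g.natDegree < n) (N : ℕ) (l : ℕ → ℕ)
    (hl : ∀ i < n, N ≤ n * l i + i ∧ n * l i + i < N + n) :
    ((N / n : ℚ) : WithTop ℚ) ≤ w (aeval α g) ↔
      ∀ i < n, ((l i : ℚ) : WithTop ℚ) ≤ w (algebraMap ℚ_[p] Ω (g.coeff i)) := by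
  have hn : (0 : ℚ) < n := by exact_mod_cast (Nat.zero_le _).trans_lt hg
  rw [map_aeval_eq_inf hw hα hg, Finset.le_inf_iff]
  simp only [Finset.mem_range]
  refine forall₂_congr fun i hi => ?_
  obtain hi' | ⟨a, ha⟩ := map_algebraMap_eq_top_or_int hw (g.coeff i)
  · simp [hi']
  obtain ⟨h1, h2⟩ := hl i hi
  rw [ha, ← WithTop.coe_add, WithTop.coe_le_coe, WithTop.coe_le_coe, div_le_iff₀ hn, add_mul,
    div_mul_cancel₀ _ hn.ne']
  have e1 : ((N : ℚ) ≤ a * n + i) ↔ (N : ℤ) ≤ a * n + i := by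
    rw [← @Int.cast_le ℚ]; push_cast; rfl
  have e2 : ((l i : ℚ) ≤ a) ↔ (l i : ℤ) ≤ a := by rw [← @Int.cast_le ℚ]; push_cast; rfl
  rw [e1, e2]
  zify at h1 h2
  constructor
  · intro h
    by_contra! hlt
    nlinarith
  · intro h
    nlinarith

theorem map_aeval_eq_iff {g : ℚ_[p][X]} (hg : g.natDegree < n) (N : ℕ) :
    w (aeval α g) = ((N / n : ℚ) : WithTop ℚ) ↔
      ((N / n : ℚ) : WithTop ℚ) ≤ w (aeval α g) ∧
        ¬ (((N + 1 : ℕ) / n : ℚ) : WithTop ℚ) ≤ w (aeval α g) := by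
  have hn : (0 : ℚ) < n := by exact_mod_cast (Nat.zero_le _).trans_lt hg
  rw [map_aeval_eq_inf hw hα hg]
  obtain ⟨i, -, hi⟩ := (Finset.range n).exists_mem_eq_inf
    ⟨0, Finset.mem_range.2 ((Nat.zero_le _).trans_lt hg)⟩
    fun i => w (algebraMap ℚ_[p] Ω (g.coeff i)) + ((i / n : ℚ) : WithTop ℚ)
  rw [hi]
  obtain hi' | ⟨a, ha⟩ := map_algebraMap_eq_top_or_int hw (g.coeff i)
  · simp [hi']
  rw [ha, ← WithTop.coe_add, WithTop.coe_le_coe, WithTop.coe_le_coe, WithTop.coe_inj,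
    div_le_iff₀ hn, div_le_iff₀ hn, eq_div_iff hn.ne', add_mul, div_mul_cancel₀ _ hn.ne']
  norm_cast
  omega

theorem map_aeval_eq_iff_isBounded {g : ℚ_[p][X]} (hg : g.natDegree < n) {N j : ℕ} (l : ℕ → ℕ)
    (hl : ∀ i < n, N ≤ n * l i + i ∧ n * l i + i < N + n) (hj : j < n) (hN : n * l j + j = N) :
    w (aeval α g) = ((N / n : ℚ) : WithTop ℚ) ↔
      ∀ i < n, w.IsBounded (l i) (i = j) (g.coeff i) := by
  rw [map_aeval_eq_iff hw hα hg, le_map_aeval_iff hw hα hg N l hl,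
    le_map_aeval_iff hw hα hg (N + 1) (Function.update l j (l j + 1)) fun i hi => ?_]
  · refine ⟨fun ⟨h1, h2⟩ i hi => ⟨h1 i hi, ?_⟩, fun h => ⟨fun i hi => (h i hi).1, fun h' => ?_⟩⟩
    · rintro rfl h
      refine h2 fun k hk => ?_
      by_cases hki : k = i
      · subst hki
        rwa [Function.update_self]
      · rw [Function.update_of_ne hki]
        exact h1 k hk
    · have := h' j hj
      rw [Function.update_self] at this
      exact (h j hj).2 rfl this
  · by_cases hij : i = j
    · subst hij
      rw [Function.update_self, mul_add]
      omega
    · rw [Function.update_of_ne hij]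
      obtain ⟨h1, h2⟩ := hl i hi
      have : n * l i + i ≠ N := fun h => hij <| by
        rw [← hN] at h
        simpa [Nat.mod_eq_of_lt hi, Nat.mod_eq_of_lt hj] using congrArg (· % n) h
      omega

theorem aeval_ne_zero_of_natDegree_lt {g : ℚ_[p][X]} (hg : g.natDegree < n) (h0 : g ≠ 0) :
    aeval α g ≠ 0 := by
  rw [← w.ne_top_iff, map_aeval_eq_inf hw hα hg]
  intro h
  have h1 := (Finset.inf_eq_top_iff _ _).1 h g.natDegree (Finset.mem_range.2 hg)
  have h2 : w (algebraMap ℚ_[p] Ω g.leadingCoeff) = ⊤ := by simpa using h1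
  exact h0 (by simpa using h2)

theorem eq_minpoly_of_natDegree_eq {f : ℚ_[p][X]} (hf : f.Monic) (hfn : f.natDegree = n)
    (h : aeval α f = 0) : f = minpoly ℚ_[p] α := by
  refine minpoly.unique' _ _ hf h fun q hq => ?_
  rw [or_iff_not_imp_left]
  intro hq0
  exact aeval_ne_zero_of_natDegree_lt hw hα (hfn ▸ natDegree_lt_natDegree hq0 hq) hq0

theorem le_natDegree_minpoly (hint : IsIntegral ℚ_[p] α) :
    n ≤ (minpoly ℚ_[p] α).natDegree := by
  by_contra! h
  exact aeval_ne_zero_of_natDegree_lt hw hα h (minpoly.ne_zero hint) (minpoly.aeval _ _)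

end Uniformizer

omit hw in
theorem map_root_of_eisenstein {n : ℕ} (hn : 0 < n) {f : ℚ_[p][X]} (hf : f.Monic)
    (hfn : f.natDegree = n) (h1 : ∀ i < n, 1 ≤ w (algebraMap ℚ_[p] Ω (f.coeff i)))
    (h0 : w (algebraMap ℚ_[p] Ω (f.coeff 0)) = 1) {α : Ω} (hα : aeval α f = 0) :
    w α = ((1 / n : ℚ) : WithTop ℚ) := by
  obtain ⟨m, rfl⟩ : ∃ m, n = m + 1 := ⟨n - 1, by omega⟩
  rw [aeval_eq_sum_range, hfn, Finset.sum_range_succ, ← hfn, hf.coeff_natDegree, one_smul, hfn,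
    Finset.sum_range_succ'] at hα
  simp only [Algebra.smul_def, pow_zero, mul_one] at hα
  have hα0 : α ≠ 0 := by
    rintro rfl
    simp only [zero_pow (Nat.succ_ne_zero _), mul_zero, Finset.sum_const_zero, zero_add,
      add_zero] at hα
    rw [hα, w.map_zero] at h0
    exact WithTop.top_ne_one h0
  obtain ⟨a, ha⟩ := WithTop.ne_top_iff_exists.1 (w.ne_top_iff.2 hα0)
  have hpow : ∀ i : ℕ, w (α ^ i) = ((i * a : ℚ) : WithTop ℚ) := w.map_pow_of_eq ha.symm
  have hneg : w (∑ i ∈ Finset.range m, algebraMap ℚ_[p] Ω (f.coeff (i + 1)) * α ^ (i + 1) +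
      algebraMap ℚ_[p] Ω (f.coeff 0)) = (((m + 1 : ℕ) * a : ℚ) : WithTop ℚ) := by
    rw [← hpow, ← w.map_neg (α ^ (m + 1)), eq_neg_of_add_eq_zero_left hα]
  have hterm : ∀ i < m, ((1 + (i + 1 : ℕ) * a : ℚ) : WithTop ℚ) ≤
      w (algebraMap ℚ_[p] Ω (f.coeff (i + 1)) * α ^ (i + 1)) := fun i hi => by
    rw [w.map_mul, hpow, WithTop.coe_add]
    exact add_le_add_left (h1 _ (by omega)) _
  have hpos : 0 < a := by
    by_contra! hle
    have : ((1 + m * a : ℚ) : WithTop ℚ) ≤ (((m + 1 : ℕ) * a : ℚ) : WithTop ℚ) := by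
      rw [← hneg]
      refine w.map_le_add (w.map_le_sum fun i hi => le_trans ?_ (hterm i (Finset.mem_range.1 hi))) ?_
      · rw [WithTop.coe_le_coe]
        have : ((i + 1 : ℕ) : ℚ) ≤ m := by exact_mod_cast Finset.mem_range.1 hi
        nlinarith
      · rw [h0, ← WithTop.coe_one, WithTop.coe_le_coe]
        nlinarith [(Nat.cast_nonneg m : (0 : ℚ) ≤ m)]
    rw [WithTop.coe_le_coe] at this
    push_cast at this
    nlinarith
  have hlt : w (algebraMap ℚ_[p] Ω (f.coeff 0)) <
      w (∑ i ∈ Finset.range m, algebraMap ℚ_[p] Ω (f.coeff (i + 1)) * α ^ (i + 1)) := by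
    rw [h0]
    refine w.map_lt_sum WithTop.one_ne_top fun i hi =>
      lt_of_lt_of_le ?_ (hterm i (Finset.mem_range.1 hi))
    rw [← WithTop.coe_one, WithTop.coe_lt_coe]
    have : (0 : ℚ) < (i + 1 : ℕ) := by positivity
    nlinarith
  rw [w.map_add_eq_of_lt_right hlt, h0, ← WithTop.coe_one, WithTop.coe_inj] at hneg
  rw [← ha, WithTop.coe_inj, eq_div_iff (by positivity)]
  linarith

theorem map_eq_natCast_iff (x : ℚ_[p]) (l : ℕ) :
    w (algebraMap ℚ_[p] Ω x) = ((l : ℚ) : WithTop ℚ) ↔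
      ((l : ℚ) : WithTop ℚ) ≤ w (algebraMap ℚ_[p] Ω x) ∧
        ¬ (((l + 1 : ℕ) : ℚ) : WithTop ℚ) ≤ w (algebraMap ℚ_[p] Ω x) := by
  obtain h | ⟨a, ha⟩ := map_algebraMap_eq_top_or_int hw x
  · simp [h]
  rw [ha, WithTop.coe_le_coe, WithTop.coe_le_coe, WithTop.coe_inj]
  norm_cast
  omega

theorem coeff_of_isRoot {n : ℕ} (hn : 0 < n) {f : ℚ_[p][X]} (hf : f.Monic)
    (hfn : f.natDegree = n) {α : Ω} (hα : aeval α f = 0)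
    (hwα : w α = ((1 / n : ℚ) : WithTop ℚ)) :
    (∀ i < n, 1 ≤ w (algebraMap ℚ_[p] Ω (f.coeff i))) ∧
      w (algebraMap ℚ_[p] Ω (f.coeff 0)) = 1 := by
  have hg : (f - X ^ n).natDegree < n :=
    IsMonicOfDegree.natDegree_sub_X_pow hn.ne' ⟨hfn, hf⟩
  have hcoeff : ∀ i < n, (f - X ^ n).coeff i = f.coeff i := fun i hi => by
    simp [coeff_X_pow, hi.ne]
  have hval : w (aeval α (f - X ^ n)) = ((n / n : ℚ) : WithTop ℚ) := by
    rw [_root_.map_sub, hα, zero_sub, w.map_neg, _root_.map_pow, aeval_X, w.map_pow_of_eq hwα, mul_one_div]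
  have hbound : ∀ i < n, w.IsBounded 1 (i = 0) (f.coeff i) := fun i hi => by
    rw [← hcoeff i hi]
    exact (map_aeval_eq_iff_isBounded hw hwα hg (fun _ => 1) (fun i hi => by omega) hn
      (by omega)).1 hval i hi
  refine ⟨fun i hi => by simpa using (hbound i hi).1, ?_⟩
  simpa using (map_eq_natCast_iff hw (f.coeff 0) 1).2 ⟨(hbound 0 hn).1, (hbound 0 hn).2 rfl⟩

omit hw in
theorem aeval_eq_prod_roots [IsAlgClosed Ω] [DecidableEq Ω] {f : ℚ_[p][X]} (hf : f.Monic)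
    (hs : f.Separable) (β : Ω) : aeval β f = ∏ r ∈ (f.aroots Ω).toFinset, (β - r) := by
  rw [(IsAlgClosed.splits _).aeval_eq_prod_aroots_of_monic hf, Finset.prod,
    Multiset.toFinset_val, (nodup_roots hs.map).dedup]

omit hw in
theorem aeval_derivative_eq_prod_roots [IsAlgClosed Ω] [DecidableEq Ω] {f : ℚ_[p][X]}
    (hf : f.Monic) (hs : f.Separable) {r : Ω} (hr : aeval r f = 0) :
    aeval r (derivative f) = ∏ r' ∈ (f.aroots Ω).toFinset.erase r, (r - r') := by
  have hnd : (f.aroots Ω).Nodup := nodup_roots hs.map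
  have hmem : r ∈ f.aroots Ω := (mem_aroots).2 ⟨hf.ne_zero, hr⟩
  rw [← eval_map_algebraMap, ← derivative_map,
    (IsAlgClosed.splits _).eval_root_derivative (hf.map _) hmem, Finset.prod, Finset.erase_val,
    Multiset.toFinset_val, hnd.dedup]

omit hw in
theorem card_roots_toFinset [IsAlgClosed Ω] [DecidableEq Ω] {f : ℚ_[p][X]}
    (hf : f.Monic) (hs : f.Separable) : (f.aroots Ω).toFinset.card = f.natDegree := by
  rw [Multiset.toFinset_card_of_nodup (nodup_roots hs.map),
    ← (IsAlgClosed.splits _).natDegree_eq_card_roots, hf.natDegree_map]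

section Roots

variable [IsAlgClosed Ω] {f : ℚ_[p][X]} (hf : f.Monic) (hs : f.Separable)

include hf hs

omit hw in
theorem map_sub_root_lt_one {n : ℕ} (hfn : f.natDegree = n) (hn : 2 ≤ n)
    (hroot : ∀ r : Ω, aeval r f = 0 → w r = ((1 / n : ℚ) : WithTop ℚ)) {d : ℚ}
    (hd : d < 1 + (n - 2) / n) {r r' : Ω} (hr : aeval r f = 0) (hr' : aeval r' f = 0)
    (hne : r' ≠ r) (hder : w (aeval r (derivative f)) = (d : WithTop ℚ)) : w (r - r') < 1 := by
  classical
  have hmem : ∀ {r : Ω}, r ∈ (f.aroots Ω).toFinset ↔ aeval r f = 0 := fun {r} => by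
    rw [Multiset.mem_toFinset, mem_aroots, and_iff_right hf.ne_zero]
  have hle : ∀ s ∈ ((f.aroots Ω).toFinset.erase r).erase r',
      ((1 / n : ℚ) : WithTop ℚ) ≤ w (r - s) := fun s hs => by
    have hs' := hmem.1 (Finset.mem_of_mem_erase (Finset.mem_of_mem_erase hs))
    exact w.map_le_sub (hroot r hr).ge (hroot s hs').ge
  have hsum := Finset.card_nsmul_le_sum _ _ _ hle
  have h1 : r' ∈ (f.aroots Ω).toFinset.erase r := Finset.mem_erase.2 ⟨hne, hmem.2 hr'⟩
  rw [Finset.card_erase_of_mem h1, Finset.card_erase_of_mem (hmem.2 hr),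
    card_roots_toFinset hf hs, hfn, ← WithTop.coe_nsmul] at hsum
  rw [aeval_derivative_eq_prod_roots hf hs hr, map_prod_eq_sum, ← Finset.add_sum_erase _ _ h1]
    at hder
  by_contra! h
  have h2 := (add_le_add h hsum).trans_eq hder
  rw [← WithTop.coe_one, ← WithTop.coe_add, WithTop.coe_le_coe, nsmul_eq_mul, mul_one_div,
    Nat.sub_sub, Nat.cast_sub hn] at h2
  push_cast at h2
  linarith

omit hw in
theorem le_map_aeval_iff_exists_root (hdeg : f.natDegree ≠ 0) {c : WithTop ℚ} {d : ℚ}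
    (hsep : ∀ r r' : Ω, aeval r f = 0 → aeval r' f = 0 → r' ≠ r → w (r - r') < c)
    (hder : ∀ r : Ω, aeval r f = 0 → w (aeval r (derivative f)) = (d : WithTop ℚ)) (β : Ω) :
    c + d ≤ w (aeval β f) ↔ ∃ r, aeval r f = 0 ∧ c ≤ w (β - r) := by
  classical
  have hmem : ∀ {r : Ω}, r ∈ (f.aroots Ω).toFinset ↔ aeval r f = 0 := fun {r} => by
    rw [Multiset.mem_toFinset, mem_aroots, and_iff_right hf.ne_zero]
  have hval : ∀ r : Ω, aeval r f = 0 → w (aeval β f) =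
      w (β - r) + ∑ r' ∈ (f.aroots Ω).toFinset.erase r, w (β - r') := fun r hr => by
    rw [aeval_eq_prod_roots hf hs, map_prod_eq_sum]
    exact (Finset.add_sum_erase _ (fun r => w (β - r)) (hmem.2 hr)).symm
  have hval' : ∀ r : Ω, aeval r f = 0 →
      ∑ r' ∈ (f.aroots Ω).toFinset.erase r, w (r - r') = d := fun r hr => by
    rw [← hder r hr, aeval_derivative_eq_prod_roots hf hs hr, map_prod_eq_sum]
  constructor
  · intro h
    by_contra! hlt
    obtain ⟨r₀, hr₀, hmax⟩ := (f.aroots Ω).toFinset.exists_max_image (fun r => w (β - r))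
      (by rw [← Finset.card_pos, card_roots_toFinset hf hs]; omega)
    rw [hmem] at hr₀
    have hle : ∑ r' ∈ (f.aroots Ω).toFinset.erase r₀, w (β - r') ≤ d := by
      rw [← hval' r₀ hr₀]
      refine Finset.sum_le_sum fun r hr => ?_
      have : r₀ - r = (β - r) - (β - r₀) := by ring
      rw [this]
      exact w.map_le_sub le_rfl (hmax r (Finset.mem_of_mem_erase hr))
    rw [hval r₀ hr₀] at h
    exact absurd (h.trans (add_le_add_right hle _))
      (not_le.2 (WithTop.add_lt_add_right (WithTop.coe_ne_top) (hlt r₀ hr₀)))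
  · rintro ⟨r, hr, hc⟩
    rw [hval r hr, ← hval' r hr]
    refine add_le_add hc (Finset.sum_le_sum fun r' hr' => ?_)
    have h1 := hsep r r' hr (hmem.1 (Finset.mem_of_mem_erase hr')) (Finset.ne_of_mem_erase hr')
    have : β - r' = (r - r') + (β - r) := by ring
    rw [this]
    exact w.map_le_add le_rfl (h1.le.trans hc)

end Roots

theorem le_map_algebraMap_iff (x : ℚ_[p]) (k : ℕ) :
    ((k : ℚ) : WithTop ℚ) ≤ w (algebraMap ℚ_[p] Ω x) ↔ ‖x‖ ≤ (p : ℝ) ^ (-k : ℤ) := by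
  rcases eq_or_ne x 0 with rfl | hx
  · simp
  have hp : (1 : ℝ) < p := by exact_mod_cast (Fact.out : p.Prime).one_lt
  rw [hw x hx, WithTop.coe_le_coe, Padic.norm_eq_zpow_neg_valuation hx,
    zpow_le_zpow_iff_right₀ hp, neg_le_neg_iff]
  norm_cast

theorem le_map_natCast_iff (t k : ℕ) :
    ((k : ℚ) : WithTop ℚ) ≤ w (algebraMap ℚ_[p] Ω (t : ℚ_[p])) ↔ p ^ k ∣ t := by
  rw [le_map_algebraMap_iff hw, ← Int.cast_natCast (R := ℚ_[p]), Padic.norm_int_le_pow_iff_dvd]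
  norm_cast

theorem exists_natCast_approx {x : ℚ_[p]} (hx : 0 ≤ w (algebraMap ℚ_[p] Ω x)) (c : ℕ) :
    ∃ t < p ^ c, ((c : ℚ) : WithTop ℚ) ≤ w (algebraMap ℚ_[p] Ω (x - t)) := by
  have h0 : ‖x‖ ≤ 1 := by simpa using (le_map_algebraMap_iff hw x 0).1 (by simpa using hx)
  refine ⟨PadicInt.appr ⟨x, h0⟩ c, PadicInt.appr_lt _ _, ?_⟩
  have h := (PadicInt.norm_le_pow_iff_mem_span_pow _ _).2 (PadicInt.appr_spec c ⟨x, h0⟩)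
  rw [le_map_algebraMap_iff hw]
  exact h

omit hw in
theorem le_map_congr {x y : Ω} {a b : WithTop ℚ} (hab : a ≤ b) (h : b ≤ w (x - y)) :
    a ≤ w x ↔ a ≤ w y := by
  constructor
  · intro hx
    have := w.map_le_sub hx (hab.trans h)
    rwa [sub_sub_cancel] at this
  · intro hy
    have := w.map_le_add (hab.trans h) hy
    rwa [sub_add_cancel] at this

/-- The natural representatives modulo `p ^ c` of the elements of `ℚ_[p]` whose valuation is at
least `l`, with equality if `u` holds. -/
def residues (p l : ℕ) (u : Prop) [Decidable u] (c : ℕ) : Finset ℕ :=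
  (Finset.range (p ^ c)).filter fun t => p ^ l ∣ t ∧ (u → ¬ p ^ (l + 1) ∣ t)

theorem isBounded_natCast {l c t : ℕ} {u : Prop} [Decidable u] (ht : t ∈ residues p l u c) :
    w.IsBounded l u (t : ℚ_[p]) := by
  simp only [residues, Finset.mem_filter] at ht
  simpa only [IsBounded, le_map_natCast_iff hw] using ht.2

theorem exists_mem_residues {l c : ℕ} {u : Prop} [Decidable u] (hl : l ≤ c) (hu : u → l + 1 ≤ c)
    {x : ℚ_[p]} (hx : w.IsBounded l u x) :
    ∃ t ∈ residues p l u c, ((c : ℚ) : WithTop ℚ) ≤ w (algebraMap ℚ_[p] Ω (x - (t : ℕ))) := by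
  have h0 : 0 ≤ w (algebraMap ℚ_[p] Ω x) := le_trans (by exact_mod_cast l.zero_le) hx.1
  obtain ⟨t, ht, h⟩ := exists_natCast_approx hw h0 c
  refine ⟨t, ?_, h⟩
  rw [_root_.map_sub] at h
  simp only [residues, Finset.mem_filter, Finset.mem_range, ← le_map_natCast_iff hw]
  refine ⟨ht, (le_map_congr (by exact_mod_cast hl) h).1 hx.1, fun hu' => ?_⟩
  rw [← le_map_congr (by exact_mod_cast hu hu') h]
  exact hx.2 hu'

theorem eq_of_mem_residues {l c t t' : ℕ} {u : Prop} [Decidable u] (ht : t ∈ residues p l u c)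
    (ht' : t' ∈ residues p l u c)
    (h : ((c : ℚ) : WithTop ℚ) ≤ w (algebraMap ℚ_[p] Ω ((t : ℚ_[p]) - (t' : ℚ_[p])))) :
    t = t' := by
  simp only [residues, Finset.mem_filter, Finset.mem_range] at ht ht'
  rw [le_map_algebraMap_iff hw, ← Int.cast_natCast (R := ℚ_[p]),
    ← Int.cast_natCast (R := ℚ_[p]) t', ← Int.cast_sub, Padic.norm_int_le_pow_iff_dvd] at h
  exact (Nat.ModEq.eq_of_lt_of_lt ((Nat.modEq_iff_dvd.2 (by exact_mod_cast h))) ht'.1 ht.1).symm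

/-- Families of `p`-adic digits indexed by `i < n`, the `i`-th one in `residues p (l i) (u i) (c i)`. -/
abbrev Digits (p n : ℕ) (l : ℕ → ℕ) (u : ℕ → Prop) [DecidablePred u] (c : ℕ → ℕ) : Type :=
  ∀ i : Fin n, residues p (l i) (u i) (c i)

namespace Digits

variable {n : ℕ} {l c : ℕ → ℕ} {u : ℕ → Prop} [DecidablePred u]

/-- The polynomial whose coefficients are the given digits. -/
noncomputable def toPoly (t : Digits p n l u c) : ℚ_[p][X] :=
  ∑ i : Fin n, C ((t i : ℕ) : ℚ_[p]) * X ^ (i : ℕ)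

omit [Field Ω] [Algebra ℚ_[p] Ω] hw in
theorem coeff_toPoly (t : Digits p n l u c) (i : Fin n) :
    t.toPoly.coeff i = ((t i : ℕ) : ℚ_[p]) := by
  simp [toPoly, coeff_X_pow, Fin.val_inj]

omit [Field Ω] [Algebra ℚ_[p] Ω] hw in
theorem degree_toPoly_lt (t : Digits p n l u c) : t.toPoly.degree < n := by
  refine (degree_sum_le _ _).trans_lt ((Finset.sup_lt_iff (WithBot.bot_lt_coe n)).2 fun i _ => ?_)
  exact (degree_C_mul_X_pow_le _ _).trans_lt (WithBot.coe_lt_coe.2 i.2)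

omit [Field Ω] [Algebra ℚ_[p] Ω] hw in
theorem natDegree_toPoly_lt (hn : 0 < n) (t : Digits p n l u c) : t.toPoly.natDegree < n := by
  by_cases h : t.toPoly = 0
  · rwa [h, natDegree_zero]
  · exact (natDegree_lt_iff_degree_lt h).2 t.degree_toPoly_lt

include hw

theorem isBounded_coeff_toPoly (t : Digits p n l u c) {i : ℕ} (hi : i < n) :
    w.IsBounded (l i) (u i) (t.toPoly.coeff i) := by
  rw [t.coeff_toPoly ⟨i, hi⟩]
  exact isBounded_natCast hw (t ⟨i, hi⟩).2

theorem exists_toPoly (hl : ∀ i < n, l i ≤ c i ∧ (u i → l i + 1 ≤ c i)) {g : ℚ_[p][X]}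
    (hg : ∀ i < n, w.IsBounded (l i) (u i) (g.coeff i)) :
    ∃ t : Digits p n l u c, ∀ i < n,
      ((c i : ℚ) : WithTop ℚ) ≤ w (algebraMap ℚ_[p] Ω ((g - t.toPoly).coeff i)) := by
  choose t ht h using fun i : Fin n =>
    exists_mem_residues hw (hl i i.2).1 (hl i i.2).2 (hg i i.2)
  refine ⟨fun i => ⟨t i, ht i⟩, fun i hi => ?_⟩
  rw [coeff_sub, coeff_toPoly _ ⟨i, hi⟩]
  exact h ⟨i, hi⟩

theorem toPoly_injective_mod {t t' : Digits p n l u c} (h : ∀ i < n,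
    ((c i : ℚ) : WithTop ℚ) ≤ w (algebraMap ℚ_[p] Ω ((t.toPoly - t'.toPoly).coeff i))) :
    t = t' := by
  funext i
  have := h i i.2
  rw [coeff_sub, coeff_toPoly, coeff_toPoly] at this
  exact Subtype.ext (eq_of_mem_residues hw (t i).2 (t' i).2 this)

end Digits

/-- The element `α` has degree `n` over `ℚ_[p]` and valuation `1 / n`, and the derivative of its
minimal polynomial has valuation `d` at `α`; so `α` is a uniformizer generating a totally ramified
extension of degree `n` and discriminant exponent `n * d`. -/
structure IsGenerator (w : AddValuation Ω (WithTop ℚ)) (n : ℕ) (d : ℚ) (α : Ω) : Prop where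
  map_eq : w α = ((1 / n : ℚ) : WithTop ℚ)
  natDegree_eq : (minpoly ℚ_[p] α).natDegree = n
  map_derivative_eq : w (aeval α (derivative (minpoly ℚ_[p] α))) = (d : WithTop ℚ)

theorem map_aeval_eq_one_div_iff {n : ℕ} (hn : 2 ≤ n) {q : ℚ_[p][X]} (hq : q.natDegree < n) {x : Ω}
    (hx : w x = ((1 / n : ℚ) : WithTop ℚ)) :
    w (aeval x q) = ((1 / n : ℚ) : WithTop ℚ) ↔
      ∀ i < n, w.IsBounded (if i = 0 then 1 else 0) (i = 1) (q.coeff i) := by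
  simpa using map_aeval_eq_iff_isBounded hw hx hq (N := 1) (fun i => if i = 0 then 1 else 0)
    (fun i hi => by split_ifs <;> omega) (j := 1) (by omega) (by simp)

theorem map_aeval_sub_aeval {n : ℕ} (hn : 2 ≤ n) {q : ℚ_[p][X]} (hq : q.natDegree < n) {x y : Ω}
    (hx : w x = ((1 / n : ℚ) : WithTop ℚ)) (hy : w y = ((1 / n : ℚ) : WithTop ℚ))
    (hqx : w (aeval x q) = ((1 / n : ℚ) : WithTop ℚ)) :
    w (aeval x q - aeval y q) = w (x - y) := by
  rcases eq_or_ne x y with rfl | hxy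
  · simp
  have hbound := (map_aeval_eq_one_div_iff hw hn hq hx).1 hqx
  have hnonneg : ∀ i < n, 0 ≤ w (algebraMap ℚ_[p] Ω (q.coeff i)) := fun i hi =>
    le_trans (by exact_mod_cast Nat.zero_le _) (hbound i hi).1
  have hb1 : w (algebraMap ℚ_[p] Ω (q.coeff 1)) = 0 := by
    simpa using (map_eq_natCast_iff hw (q.coeff 1) 0).2
      ⟨by simpa using hnonneg 1 hn, by simpa using (hbound 1 hn).2 rfl⟩
  obtain ⟨m, rfl⟩ : ∃ m, n = m + 2 := ⟨n - 2, by omega⟩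
  have hdiff : aeval x q - aeval y q = algebraMap ℚ_[p] Ω (q.coeff 1) * (x - y) +
      ∑ i ∈ Finset.range m, algebraMap ℚ_[p] Ω (q.coeff (i + 2)) * (x ^ (i + 2) - y ^ (i + 2)) := by
    rw [aeval_eq_sum_range' hq, aeval_eq_sum_range' hq, ← Finset.sum_sub_distrib,
      Finset.sum_range_succ', Finset.sum_range_succ']
    simp only [Algebra.smul_def, mul_sub]
    simp
    ring
  obtain ⟨s, hs⟩ := WithTop.ne_top_iff_exists.1 (w.ne_top_iff.2 (sub_ne_zero.2 hxy))
  have hlin : w (algebraMap ℚ_[p] Ω (q.coeff 1) * (x - y)) = (s : WithTop ℚ) := by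
    rw [w.map_mul, hb1, zero_add, hs]
  rw [hdiff, w.map_add_eq_of_lt_left, hlin, hs]
  rw [hlin]
  refine w.map_lt_sum WithTop.coe_ne_top fun i hi => ?_
  have hlt : ((s : ℚ) : WithTop ℚ) < ((s + (i + 1 : ℕ) * (1 / (m + 2 : ℕ)) : ℚ) : WithTop ℚ) := by
    rw [WithTop.coe_lt_coe]
    have : (0 : ℚ) < (i + 1 : ℕ) * (1 / (m + 2 : ℕ)) := by positivity
    linarith
  refine hlt.trans_le ?_
  rw [← (Commute.all x y).mul_geom_sum₂, w.map_mul, w.map_mul, WithTop.coe_add, ← hs]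
  refine (add_le_add le_rfl (w.map_le_sum fun j hj => ?_)).trans
    (le_add_of_nonneg_left (hnonneg _ (by have := Finset.mem_range.1 hi; omega)))
  have hj := Finset.mem_range.1 hj
  rw [w.map_mul, w.map_pow_of_eq hx, w.map_pow_of_eq hy, ← WithTop.coe_add, ← add_mul]
  norm_cast
  rw [show j + (i + 2 - 1 - j) = i + 1 by omega]

omit hw in
theorem monic_minpoly [Algebra.IsAlgebraic ℚ_[p] Ω] (α : Ω) : (minpoly ℚ_[p] α).Monic :=
  minpoly.monic (Algebra.IsIntegral.isIntegral α)

omit hw in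
theorem separable_minpoly [Algebra.IsAlgebraic ℚ_[p] Ω] (α : Ω) :
    (minpoly ℚ_[p] α).Separable :=
  (minpoly.irreducible (Algebra.IsIntegral.isIntegral α)).separable

namespace IsGenerator

variable [Algebra.IsAlgebraic ℚ_[p] Ω] {n : ℕ} {d : ℚ} {α : Ω} (hα : w.IsGenerator (p := p) n d α)

include hα

theorem map_root (hn : 0 < n) {r : Ω} (hr : aeval r (minpoly ℚ_[p] α) = 0) :
    w r = ((1 / n : ℚ) : WithTop ℚ) := by
  obtain ⟨h1, h0⟩ := coeff_of_isRoot hw hn (monic_minpoly α) hα.natDegree_eq (minpoly.aeval _ α)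
    hα.map_eq
  exact map_root_of_eisenstein hn (monic_minpoly α) hα.natDegree_eq h1 h0 hr

omit hw in
theorem exists_aeval_eq {β : Ω} (hβα : β ∈ IntermediateField.adjoin ℚ_[p] {α}) :
    ∃ q : ℚ_[p][X], q.natDegree < n ∧ aeval α q = β := by
  have hint := Algebra.IsIntegral.isIntegral (R := ℚ_[p]) α
  obtain ⟨q, hq, h⟩ := (IntermediateField.adjoin.powerBasis hint).exists_eq_aeval ⟨β, hβα⟩
  rw [IntermediateField.adjoin.powerBasis_dim, hα.natDegree_eq] at hq
  refine ⟨q, hq, ?_⟩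
  rw [IntermediateField.adjoin.powerBasis_gen] at h
  simpa [← IntermediateField.aeval_coe] using (congrArg Subtype.val h).symm

theorem of_mem_adjoin [IsAlgClosed Ω] (hn : 2 ≤ n) {β : Ω}
    (hβα : β ∈ IntermediateField.adjoin ℚ_[p] {α}) (hβ : w β = ((1 / n : ℚ) : WithTop ℚ)) :
    w.IsGenerator (p := p) n d β ∧
      IntermediateField.adjoin ℚ_[p] {β} = IntermediateField.adjoin ℚ_[p] {α} := by
  classical
  have hint : ∀ x : Ω, IsIntegral ℚ_[p] x := Algebra.IsIntegral.isIntegral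
  have hfin := IntermediateField.adjoin.finiteDimensional (hint α)
  have hfinrank : Module.finrank ℚ_[p] (IntermediateField.adjoin ℚ_[p] {α}) = n := by
    rw [IntermediateField.adjoin.finrank (hint α), hα.natDegree_eq]
  have hle : IntermediateField.adjoin ℚ_[p] {β} ≤ IntermediateField.adjoin ℚ_[p] {α} :=
    IntermediateField.adjoin_simple_le_iff.2 hβα
  have heq : IntermediateField.adjoin ℚ_[p] {β} = IntermediateField.adjoin ℚ_[p] {α} := by
    refine IntermediateField.eq_of_le_of_finrank_le hle ?_
    rw [hfinrank, IntermediateField.adjoin.finrank (hint β)]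
    exact le_natDegree_minpoly hw hβ (hint β)
  have hdeg : (minpoly ℚ_[p] β).natDegree = n := by
    rw [← IntermediateField.adjoin.finrank (hint β), heq, hfinrank]
  obtain ⟨q, hq, hqα⟩ := hα.exists_aeval_eq hβα
  refine ⟨⟨hβ, hdeg, ?_⟩, heq⟩
  have hmem : ∀ {x r : Ω}, r ∈ ((minpoly ℚ_[p] x).aroots Ω).toFinset ↔
      aeval r (minpoly ℚ_[p] x) = 0 := fun {x r} => by
    rw [Multiset.mem_toFinset, mem_aroots, and_iff_right (minpoly.ne_zero (hint x))]
  have hdvd : minpoly ℚ_[p] α ∣ (minpoly ℚ_[p] β).comp q := minpoly.dvd _ _ (by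
    rw [aeval_comp, hqα, minpoly.aeval])
  have hroot : ∀ r : Ω, aeval r (minpoly ℚ_[p] α) = 0 → aeval (aeval r q) (minpoly ℚ_[p] β) = 0 :=
    fun r hr => by rw [← aeval_comp, aeval_eq_zero_of_dvd_aeval_eq_zero hdvd hr]
  have hn0 : 0 < n := by omega
  have hdiff : ∀ r : Ω, aeval r (minpoly ℚ_[p] α) = 0 → w (β - aeval r q) = w (α - r) := fun r hr => by
    rw [← hqα, map_aeval_sub_aeval hw hn hq hα.map_eq (hα.map_root hw hn0 hr) (hqα ▸ hβ)]
  have hinj : Set.InjOn (fun r => aeval r q)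
      (((minpoly ℚ_[p] α).aroots Ω).toFinset : Set Ω) := fun r hr r' hr' h => by
    rw [Finset.mem_coe, hmem] at hr hr'
    have hval : w (aeval r q) = ((1 / n : ℚ) : WithTop ℚ) := by
      refine map_root_of_eisenstein hn0 (monic_minpoly β) hdeg ?_ ?_ (hroot r hr)
      all_goals
        have := coeff_of_isRoot hw hn0 (monic_minpoly β) hdeg (minpoly.aeval _ β) hβ
        tauto
    have := map_aeval_sub_aeval hw hn hq (hα.map_root hw hn0 hr) (hα.map_root hw hn0 hr') hval
    dsimp only at h
    rw [h, sub_self, w.map_zero] at this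
    exact sub_eq_zero.1 (w.top_iff.1 this.symm)
  have himage : ((minpoly ℚ_[p] α).aroots Ω).toFinset.image (fun r => aeval r q) =
      ((minpoly ℚ_[p] β).aroots Ω).toFinset := by
    refine Finset.eq_of_subset_of_card_le (fun s hs => ?_) ?_
    · obtain ⟨r, hr, rfl⟩ := Finset.mem_image.1 hs
      exact hmem.2 (hroot r (hmem.1 hr))
    · rw [Finset.card_image_of_injOn hinj, card_roots_toFinset (monic_minpoly β) (separable_minpoly β), hdeg,
        card_roots_toFinset (monic_minpoly α) (separable_minpoly α), hα.natDegree_eq]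
  have hαmem : α ∈ ((minpoly ℚ_[p] α).aroots Ω).toFinset := hmem.2 (minpoly.aeval _ α)
  rw [aeval_derivative_eq_prod_roots (monic_minpoly β) (separable_minpoly β) (minpoly.aeval _ β), map_prod_eq_sum,
    ← hα.map_derivative_eq, aeval_derivative_eq_prod_roots (monic_minpoly α) (separable_minpoly α)
      (minpoly.aeval _ α), map_prod_eq_sum, ← himage]
  have herase : (((minpoly ℚ_[p] α).aroots Ω).toFinset.image (fun r => aeval r q)).erase β =
      (((minpoly ℚ_[p] α).aroots Ω).toFinset.erase α).image (fun r => aeval r q) := by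
    ext s
    simp only [Finset.mem_erase, Finset.mem_image]
    constructor
    · rintro ⟨hs, r, hr, rfl⟩
      exact ⟨r, ⟨fun h => hs (h ▸ hqα), hr⟩, rfl⟩
    · rintro ⟨r, ⟨hne, hr⟩, rfl⟩
      exact ⟨fun h => hne (hinj hr hαmem (h.trans hqα.symm)), r, hr, rfl⟩
  rw [herase, Finset.sum_image (hinj.mono (Finset.coe_subset.2 (Finset.erase_subset _ _)))]
  exact Finset.sum_congr rfl fun r hr => hdiff r (hmem.1 (Finset.mem_of_mem_erase hr))

end IsGenerator

section Count

variable [IsAlgClosed Ω] [Algebra.IsAlgebraic ℚ_[p] Ω] {n : ℕ} {d : ℚ}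

theorem IsGenerator.map_sub_lt_one {α α' : Ω} (hα : w.IsGenerator (p := p) n d α) (hn : 2 ≤ n)
    (hd : d < 1 + (n - 2) / n) (hα' : aeval α' (minpoly ℚ_[p] α) = 0) (hne : α' ≠ α) :
    w (α - α') < 1 :=
  map_sub_root_lt_one (monic_minpoly α) (separable_minpoly α) hα.natDegree_eq hn
    (fun _ hr => hα.map_root hw (by omega) hr) hd (minpoly.aeval _ α) hα' hne hα.map_derivative_eq

theorem IsGenerator.adjoin_eq {α β : Ω} (hα : w.IsGenerator (p := p) n d α)
    (hβ : w.IsGenerator (p := p) n d β) (hn : 2 ≤ n) (hd : d < 1 + (n - 2) / n)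
    (h : 1 ≤ w (α - β)) :
    IntermediateField.adjoin ℚ_[p] {α} = IntermediateField.adjoin ℚ_[p] {β} := by
  refine (hβ.of_mem_adjoin hw hn (mem_adjoin_of_forall_lt hw fun α' hα' hne => ?_) hα.map_eq).2
  exact (hα.map_sub_lt_one hw hn hd hα' hne).trans_le h

/-- Congruence modulo `p` of generators. -/
def generatorSetoid (p : ℕ) [Fact p.Prime] {Ω : Type*} [Field Ω] [Algebra ℚ_[p] Ω]
    (w : AddValuation Ω (WithTop ℚ)) (n : ℕ) (d : ℚ) :
    Setoid {α : Ω // w.IsGenerator (p := p) n d α} where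
  r α β := 1 ≤ w (α.1 - β.1)
  iseqv :=
    { refl := fun α => by simp
      symm := fun {α β} h => by rwa [w.map_sub_swap]
      trans := fun {α β γ} h h' => by
        rw [← sub_add_sub_cancel α.1 β.1 γ.1]
        exact w.map_le_add h h' }

/-- The fields generated by generators. -/
abbrev GeneratedField (p : ℕ) [Fact p.Prime] {Ω : Type*} [Field Ω] [Algebra ℚ_[p] Ω]
    (w : AddValuation Ω (WithTop ℚ)) (n : ℕ) (d : ℚ) : Type _ :=
  {L : IntermediateField ℚ_[p] Ω // ∃ α : Ω, w.IsGenerator (p := p) n d α ∧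
    L = IntermediateField.adjoin ℚ_[p] {α}}

/-- Digits of the uniformizers modulo `p` of an extension of degree `n`. -/
abbrev UniformizerDigits (p n : ℕ) : Type :=
  Digits p n (fun i => if i = 0 then 1 else 0) (fun i => i = 1) fun _ => 1

theorem card_quotient_generatorSetoid (hn : 2 ≤ n) (hd : d < 1 + (n - 2) / n) :
    Nat.card (Quotient (generatorSetoid p w n d)) =
      Nat.card (GeneratedField p w n d) * Nat.card (UniformizerDigits p n) := by
  rw [← Nat.card_prod]
  choose π hπ hL using fun L : GeneratedField p w n d => L.2
  have hn0 : 0 < n := by omega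
  have hmem : ∀ (L : GeneratedField p w n d) (q : ℚ_[p][X]),
      aeval (π L) q ∈ IntermediateField.adjoin ℚ_[p] {π L} := fun L q =>
    IntermediateField.algebra_adjoin_le_adjoin _ _ (aeval_mem_adjoin_singleton _ _)
  have hgen : ∀ x : GeneratedField p w n d × UniformizerDigits p n,
      w.IsGenerator (p := p) n d (aeval (π x.1) x.2.toPoly) ∧
        IntermediateField.adjoin ℚ_[p] {aeval (π x.1) x.2.toPoly} = x.1.1 := fun x => by
    rw [hL x.1]
    exact (hπ x.1).of_mem_adjoin hw hn (hmem _ _)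
      ((map_aeval_eq_one_div_iff hw hn (x.2.natDegree_toPoly_lt hn0) (hπ x.1).map_eq).2
        fun i hi => x.2.isBounded_coeff_toPoly hw hi)
  have hmod : ∀ (L : GeneratedField p w n d) {g : ℚ_[p][X]}, g.natDegree < n →
      (1 ≤ w (aeval (π L) g) ↔
        ∀ i < n, (((1 : ℕ) : ℚ) : WithTop ℚ) ≤ w (algebraMap ℚ_[p] Ω (g.coeff i))) :=
    fun L g hg => by
      rw [← le_map_aeval_iff hw (hπ L).map_eq hg n (fun _ => 1) (fun i hi => by omega),
        div_self (by positivity), WithTop.coe_one]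
  symm
  refine Nat.card_congr (Equiv.ofBijective
    (fun x => Quotient.mk (generatorSetoid p w n d) ⟨_, (hgen x).1⟩) ⟨?_, ?_⟩)
  · rintro ⟨L, t⟩ ⟨L', t'⟩ h
    have h1 : 1 ≤ w (aeval (π L) t.toPoly - aeval (π L') t'.toPoly) := Quotient.exact h
    obtain rfl : L = L' := Subtype.ext <| by
      rw [← (hgen (L, t)).2, ← (hgen (L', t')).2]
      exact (hgen (L, t)).1.adjoin_eq hw (hgen (L', t')).1 hn hd h1
    rw [← _root_.map_sub, hmod L ((natDegree_sub_le _ _).trans_lt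
      (max_lt (t.natDegree_toPoly_lt hn0) (t'.natDegree_toPoly_lt hn0)))] at h1
    rw [Digits.toPoly_injective_mod hw h1]
  · rintro ⟨α, hα⟩
    let L : GeneratedField p w n d := ⟨_, α, hα, rfl⟩
    obtain ⟨q, hq, hqα⟩ := (hπ L).exists_aeval_eq (β := α)
      (by rw [← hL L]; exact IntermediateField.mem_adjoin_simple_self _ _)
    obtain ⟨t, ht⟩ := Digits.exists_toPoly hw (c := fun _ => 1)
      (fun i _ => by (split_ifs <;> simp); omega)
      ((map_aeval_eq_one_div_iff hw hn hq (hπ L).map_eq).1 (hqα ▸ hα.map_eq))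
    refine ⟨(L, t), Quotient.sound ?_⟩
    change 1 ≤ w (aeval (π L) t.toPoly - α)
    rw [w.map_sub_swap, ← hqα, ← _root_.map_sub, hmod L ((natDegree_sub_le _ _).trans_lt
      (max_lt hq (t.natDegree_toPoly_lt hn0)))]
    exact ht

end Count

end Padic

section DegreeNine

variable {E : Type*} [Field E] [Algebra ℚ_[3] E] {w : AddValuation E (WithTop ℚ)}
  (hw : w.ExtendsPadic 3)

/-- The lower bounds for the valuations of the coefficients of the minimal polynomials of the
generators of degree `9` and discriminant exponent `15`. -/
def minValuation (i : ℕ) : ℕ := if i ∈ ({1, 2, 4, 5} : Finset ℕ) then 2 else 1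

/-- The precision to which a coefficient of the minimal polynomial determines the class of a
generator of degree `9` and discriminant exponent `15`. -/
def precision (i : ℕ) : ℕ := if i < 6 then 3 else 2

/-- Digits of the minimal polynomials of generators of degree `9` and discriminant
exponent `15`. -/
abbrev MinpolyDigits : Type :=
  Digits 3 9 minValuation (fun i => i = 0 ∨ i = 7) precision

theorem card_uniformizerDigits : Nat.card (UniformizerDigits 3 9) = 2 * 3 ^ 7 := by
  rw [Nat.card_pi]
  simp only [Nat.card_eq_fintype_card, Fintype.card_coe]
  decide

theorem card_minpolyDigits : Nat.card MinpolyDigits = 4 * 3 ^ 9 := by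
  rw [Nat.card_pi]
  simp only [Nat.card_eq_fintype_card, Fintype.card_coe]
  decide

include hw

theorem isBounded_mul_natCast {m e : ℕ} (h : 3 ^ e ∣ m) (h' : ¬ 3 ^ (e + 1) ∣ m) (l : ℕ) (u : Prop)
    (x : ℚ_[3]) : w.IsBounded (l + e) u (x * (m : ℚ_[3])) ↔ w.IsBounded l u x := by
  have hm := (map_eq_natCast_iff hw (m : ℚ_[3]) e).2
    ⟨(le_map_natCast_iff hw m e).2 h, fun h1 => h' ((le_map_natCast_iff hw m _).1 h1)⟩
  have key : ∀ k : ℕ, (((k + e : ℕ) : ℚ) : WithTop ℚ) ≤ w (algebraMap ℚ_[3] E (x * (m : ℚ_[3]))) ↔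
      ((k : ℚ) : WithTop ℚ) ≤ w (algebraMap ℚ_[3] E x) := fun k => by
    rw [_root_.map_mul, w.map_mul, hm, Nat.cast_add, WithTop.coe_add,
      WithTop.add_le_add_iff_right WithTop.coe_ne_top]
  rw [IsBounded, IsBounded, key, add_right_comm, key]

theorem map_aeval_derivative_eq_iff {f : ℚ_[3][X]} (hf : f.Monic) (hfn : f.natDegree = 9) {α : E}
    (hα : w α = ((1 / (9 : ℕ) : ℚ) : WithTop ℚ)) :
    w (aeval α (derivative f)) = ((15 / 9 : ℚ) : WithTop ℚ) ↔
      ∀ i < 8, w.IsBounded (minValuation (i + 1)) (i + 1 = 7) (f.coeff (i + 1)) := by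
  have hdeg : (derivative f).natDegree < 9 := by
    rw [← hfn]
    exact natDegree_derivative_lt (by omega)
  have h := map_aeval_eq_iff_isBounded hw hα hdeg (N := 15) (j := 6)
    (fun i => if i < 6 then 2 else 1) (fun i hi => by split_ifs <;> omega) (by norm_num)
    (by norm_num)
  have hdvd : ∀ i < 8, 3 ^ (if 3 ∣ i + 1 then 1 else 0) ∣ i + 1 ∧
      ¬ 3 ^ ((if 3 ∣ i + 1 then 1 else 0) + 1) ∣ i + 1 ∧
        minValuation (i + 1) + (if 3 ∣ i + 1 then 1 else 0) = if i < 6 then 2 else 1 := by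
    decide
  have hcoeff : ∀ i < 8, (w.IsBounded (if i < 6 then 2 else 1) (i = 6) ((derivative f).coeff i) ↔
      w.IsBounded (minValuation (i + 1)) (i + 1 = 7) (f.coeff (i + 1))) := fun i hi => by
    obtain ⟨h1, h2, h3⟩ := hdvd i hi
    rw [coeff_derivative, ← Nat.cast_succ, ← h3, isBounded_mul_natCast hw h1 h2,
      Nat.add_left_inj (m := i) (k := 6)]
  have hlast : w.IsBounded 1 False ((derivative f).coeff 8) := by
    refine ⟨?_, False.elim⟩
    rw [coeff_derivative, show 8 + 1 = f.natDegree from hfn.symm, hf.coeff_natDegree, ← Nat.cast_succ, one_mul, le_map_natCast_iff hw]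
    decide
  rw [Nat.cast_ofNat, Nat.cast_ofNat] at h
  rw [h]
  refine ⟨fun h i hi => (hcoeff i hi).1 (h i (by omega)), fun h i hi => ?_⟩
  rcases (by omega : i < 8 ∨ i = 8) with hi' | rfl
  · exact (hcoeff i hi').2 (h i hi')
  · simpa using hlast

theorem isBounded_coeff_iff {f : ℚ_[3][X]} (hf : f.Monic) (hfn : f.natDegree = 9) {α : E}
    (hα : aeval α f = 0) :
    (∀ i < 9, w.IsBounded (minValuation i) (i = 0 ∨ i = 7) (f.coeff i)) ↔
      w α = ((1 / (9 : ℕ) : ℚ) : WithTop ℚ) ∧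
        w (aeval α (derivative f)) = ((15 / 9 : ℚ) : WithTop ℚ) := by
  constructor
  · intro h
    have h1 : ∀ i < 9, 1 ≤ w (algebraMap ℚ_[3] E (f.coeff i)) := fun i hi => by
      refine le_trans ?_ (h i hi).1
      rw [minValuation]
      split_ifs <;> norm_num
    have h0 : w (algebraMap ℚ_[3] E (f.coeff 0)) = 1 := by
      simpa using (map_eq_natCast_iff hw (f.coeff 0) 1).2
        ⟨(h 0 (by norm_num)).1, (h 0 (by norm_num)).2 (Or.inl rfl)⟩
    have hwα := map_root_of_eisenstein (by norm_num) hf hfn h1 h0 hα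
    exact ⟨hwα, (map_aeval_derivative_eq_iff hw hf hfn hwα).2 fun i hi =>
      ⟨(h (i + 1) (by omega)).1, fun hi' => (h (i + 1) (by omega)).2 (Or.inr hi')⟩⟩
  · rintro ⟨hwα, hder⟩ i hi
    obtain ⟨h1, h0⟩ := coeff_of_isRoot hw (by norm_num) hf hfn hα hwα
    rcases i with _ | i
    · have := (map_eq_natCast_iff hw (f.coeff 0) 1).1 (by simpa using h0)
      exact ⟨this.1, fun _ => this.2⟩
    · have := (map_aeval_derivative_eq_iff hw hf hfn hwα).1 hder i (by omega)
      exact ⟨this.1, fun hi' => this.2 (hi'.resolve_left (by omega))⟩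

theorem isGenerator_of_isBounded {f : ℚ_[3][X]} (hf : f.Monic) (hfn : f.natDegree = 9)
    (h : ∀ i < 9, w.IsBounded (minValuation i) (i = 0 ∨ i = 7) (f.coeff i)) {α : E}
    (hα : aeval α f = 0) : w.IsGenerator (p := 3) 9 (15 / 9) α ∧ f = minpoly ℚ_[3] α := by
  obtain ⟨hwα, hder⟩ := (isBounded_coeff_iff hw hf hfn hα).1 h
  have hmin := eq_minpoly_of_natDegree_eq hw hwα hf hfn hα
  exact ⟨⟨hwα, hmin ▸ hfn, hmin ▸ hder⟩, hmin⟩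

theorem le_map_aeval_iff_precision {α : E} (hα : w α = ((1 / (9 : ℕ) : ℚ) : WithTop ℚ))
    {g : ℚ_[3][X]} (hg : g.natDegree < 9) :
    ((24 / 9 : ℚ) : WithTop ℚ) ≤ w (aeval α g) ↔
      ∀ i < 9, ((precision i : ℚ) : WithTop ℚ) ≤ w (algebraMap ℚ_[3] E (g.coeff i)) := by
  rw [← le_map_aeval_iff hw hα hg 24 precision fun i hi => by unfold precision; split_ifs <;> omega,
    Nat.cast_ofNat, Nat.cast_ofNat]

namespace MinpolyDigits

omit hw in
/-- The monic polynomial of degree `9` whose lower coefficients are the given digits. -/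
noncomputable def toMonic (t : MinpolyDigits) : ℚ_[3][X] := X ^ 9 + t.toPoly

omit hw in
theorem monic_toMonic (t : MinpolyDigits) : t.toMonic.Monic := monic_X_pow_add t.degree_toPoly_lt

omit hw in
theorem natDegree_toMonic (t : MinpolyDigits) : t.toMonic.natDegree = 9 := by
  rw [toMonic, natDegree_add_eq_left_of_natDegree_lt] <;> rw [natDegree_X_pow]
  exact t.natDegree_toPoly_lt (by norm_num)

omit hw in
theorem coeff_toMonic (t : MinpolyDigits) {i : ℕ} (hi : i < 9) :
    t.toMonic.coeff i = t.toPoly.coeff i := by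
  simp [toMonic, coeff_X_pow, hi.ne]

theorem isGenerator (t : MinpolyDigits) {r : E} (hr : aeval r t.toMonic = 0) :
    w.IsGenerator (p := 3) 9 (15 / 9) r ∧ t.toMonic = minpoly ℚ_[3] r :=
  by
  have h : ∀ i < 9, w.IsBounded (minValuation i) (i = 0 ∨ i = 7) (t.toMonic.coeff i) :=
    fun i hi => by
      rw [t.coeff_toMonic hi]
      exact Digits.isBounded_coeff_toPoly hw t hi
  exact isGenerator_of_isBounded hw t.monic_toMonic t.natDegree_toMonic h hr

end MinpolyDigits

variable [IsAlgClosed E] [Algebra.IsAlgebraic ℚ_[3] E]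

omit [IsAlgClosed E] in
theorem IsGenerator.isBounded_coeff_minpoly {α : E} (hα : w.IsGenerator (p := 3) 9 (15 / 9) α) :
    ∀ i < 9, w.IsBounded (minValuation i) (i = 0 ∨ i = 7) ((minpoly ℚ_[3] α).coeff i) :=
  (isBounded_coeff_iff hw (monic_minpoly α) hα.natDegree_eq (minpoly.aeval _ α)).2
    ⟨hα.map_eq, hα.map_derivative_eq⟩

theorem IsGenerator.le_map_aeval_minpoly_iff {α : E} (hα : w.IsGenerator (p := 3) 9 (15 / 9) α)
    (β : E) : ((24 / 9 : ℚ) : WithTop ℚ) ≤ w (aeval β (minpoly ℚ_[3] α)) ↔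
      ∃ r, aeval r (minpoly ℚ_[3] α) = 0 ∧ 1 ≤ w (β - r) := by
  have hroot : ∀ r : E, aeval r (minpoly ℚ_[3] α) = 0 →
      w.IsGenerator (p := 3) 9 (15 / 9) r ∧ minpoly ℚ_[3] α = minpoly ℚ_[3] r := fun r hr =>
    isGenerator_of_isBounded hw (monic_minpoly α) hα.natDegree_eq (hα.isBounded_coeff_minpoly hw) hr
  have h := le_map_aeval_iff_exists_root (monic_minpoly α) (separable_minpoly α)
    (by rw [hα.natDegree_eq]; norm_num) (c := ((1 : ℚ) : WithTop ℚ)) (fun r r' hr hr' hne =>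
      (hroot r hr).1.map_sub_lt_one hw (by norm_num) (by norm_num) ((hroot r hr).2 ▸ hr') hne)
    (fun r hr => (hroot r hr).2 ▸ (hroot r hr).1.map_derivative_eq) β
  rw [← WithTop.coe_add, WithTop.coe_one] at h
  rw [← h]
  norm_num

theorem MinpolyDigits.map_aeval_toMonic_iff (t : MinpolyDigits) (β : E) :
    ((24 / 9 : ℚ) : WithTop ℚ) ≤ w (aeval β t.toMonic) ↔
      ∃ r, aeval r t.toMonic = 0 ∧ 1 ≤ w (β - r) := by
  obtain ⟨r, hr⟩ := IsAlgClosed.exists_aeval_eq_zero E t.toMonic (by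
    rw [degree_eq_natDegree t.monic_toMonic.ne_zero, t.natDegree_toMonic]
    norm_num)
  obtain ⟨hgen, hmin⟩ := t.isGenerator hw hr
  rw [hmin]
  exact hgen.le_map_aeval_minpoly_iff hw β

theorem MinpolyDigits.card_roots (t : MinpolyDigits) :
    Nat.card {r : E // aeval r t.toMonic = 0} = 9 := by
  classical
  obtain ⟨r, hr⟩ := IsAlgClosed.exists_aeval_eq_zero E t.toMonic (by
    rw [degree_eq_natDegree t.monic_toMonic.ne_zero, t.natDegree_toMonic]
    norm_num)
  have hs : t.toMonic.Separable := (t.isGenerator hw hr).2 ▸ separable_minpoly r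
  rw [← t.natDegree_toMonic, ← card_roots_toFinset (Ω := E) t.monic_toMonic hs]
  refine Nat.subtype_card _ fun r => ?_
  rw [Multiset.mem_toFinset, mem_aroots, and_iff_right t.monic_toMonic.ne_zero]

theorem IsGenerator.exists_minpolyDigits {α : E} (hα : w.IsGenerator (p := 3) 9 (15 / 9) α) :
    ∃ (t : MinpolyDigits) (r : E), aeval r t.toMonic = 0 ∧ 1 ≤ w (α - r) := by
  obtain ⟨t, ht⟩ := Digits.exists_toPoly hw (c := precision) (by decide)
    (hα.isBounded_coeff_minpoly hw)
  change MinpolyDigits at t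
  refine ⟨t, (t.map_aeval_toMonic_iff hw α).1 ?_⟩
  have hg : (t.toMonic - minpoly ℚ_[3] α).natDegree < 9 :=
    IsMonicOfDegree.natDegree_sub_lt (by norm_num) ⟨t.natDegree_toMonic, t.monic_toMonic⟩
      ⟨hα.natDegree_eq, monic_minpoly α⟩
  rw [← sub_zero (aeval α t.toMonic), ← minpoly.aeval ℚ_[3] α, ← _root_.map_sub,
    le_map_aeval_iff_precision hw hα.map_eq hg]
  intro i hi
  have h := ht i hi
  rw [coeff_sub, _root_.map_sub] at h ⊢
  rwa [t.coeff_toMonic hi, w.map_sub_swap]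

theorem MinpolyDigits.eq_of_le_map_sub {t t' : MinpolyDigits} {r r' : E}
    (hr : aeval r t.toMonic = 0) (hr' : aeval r' t'.toMonic = 0) (h : 1 ≤ w (r - r')) :
    t = t' ∧ r = r' := by
  obtain ⟨hgen, hmin⟩ := t.isGenerator hw hr
  have ht : t = t' := by
    have h2 := (t.map_aeval_toMonic_iff hw r').2 ⟨r, hr, by rwa [w.map_sub_swap]⟩
    have h3 : t.toMonic - t'.toMonic = t.toPoly - t'.toPoly := by
      rw [toMonic, toMonic, add_sub_add_left_eq_sub]
    rw [← sub_zero (aeval r' t.toMonic), ← hr', ← _root_.map_sub, h3,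
      le_map_aeval_iff_precision hw (t'.isGenerator hw hr').1.map_eq
        ((natDegree_sub_le _ _).trans_lt (max_lt (t.natDegree_toPoly_lt (by norm_num))
          (t'.natDegree_toPoly_lt (by norm_num))))] at h2
    exact Digits.toPoly_injective_mod hw h2
  refine ⟨ht, ?_⟩
  subst ht
  by_contra hne
  exact h.not_gt (hgen.map_sub_lt_one hw (by norm_num) (by norm_num) (by rw [← hmin, hr'])
    (Ne.symm hne))

theorem card_quotient_generatorSetoid_nine :
    Nat.card (Quotient (generatorSetoid 3 w 9 (15 / 9))) = Nat.card MinpolyDigits * 9 := by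
  have hcard : Nat.card (Σ t : MinpolyDigits, {r : E // aeval r t.toMonic = 0}) =
      Nat.card MinpolyDigits * 9 := by
    have (t : MinpolyDigits) : Finite {r : E // aeval r t.toMonic = 0} :=
      Nat.finite_of_card_ne_zero (by rw [t.card_roots hw]; norm_num)
    rw [Nat.card_sigma, Finset.sum_congr rfl fun t _ => t.card_roots hw, Finset.sum_const,
      Finset.card_univ, smul_eq_mul, Nat.card_eq_fintype_card]
  rw [← hcard]
  symm
  refine Nat.card_congr (Equiv.ofBijective
    (fun x => Quotient.mk (generatorSetoid 3 w 9 (15 / 9))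
      ⟨x.2.1, (x.1.isGenerator hw x.2.2).1⟩) ⟨?_, ?_⟩)
  · rintro ⟨t, r, hr⟩ ⟨t', r', hr'⟩ h
    obtain ⟨rfl, rfl⟩ := MinpolyDigits.eq_of_le_map_sub hw hr hr' (Quotient.exact h)
    rfl
  · rintro ⟨α, hα⟩
    obtain ⟨t, r, hr, h⟩ := hα.exists_minpolyDigits hw
    refine ⟨⟨t, r, hr⟩, Quotient.sound ?_⟩
    change 1 ≤ w (r - α)
    rwa [w.map_sub_swap]

theorem card_generatedField_nine : Nat.card (GeneratedField 3 w 9 (15 / 9)) = 162 := by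
  have h1 := card_quotient_generatorSetoid_nine hw
  rw [card_quotient_generatorSetoid hw (by norm_num) (by norm_num), card_minpolyDigits,
    card_uniformizerDigits] at h1
  omega

end DegreeNine

end AddValuation

/-- There are exactly 162 totally ramified extensions of `ℚ₃` of degree 9
with discriminant `(3)^15` inside a fixed algebraic closure `Ω` of `ℚ₃`; such extensions
are exactly the fields `ℚ₃(α)` for `α` a root of an Eisenstein polynomial `f` of degree 9
with `v_α(f'(α)) = 15`. -/
theorem count_degree_nine_extensions_of_Q3
    {Ω : Type*} [Field Ω] [Algebra ℚ_[3] Ω] [IsAlgClosed Ω] [Algebra.IsAlgebraic ℚ_[3] Ω]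
    (S : PadicSetup 3 ℚ_[3] Ω) :
    Nat.card {L : IntermediateField ℚ_[3] Ω // ∃ f : Polynomial ℚ_[3],
        S.IsEisensteinOfDegree f 9 ∧ ∃ α : Ω, aeval α f = 0 ∧
          L = IntermediateField.adjoin ℚ_[3] {α} ∧
          ((9 : ℚ) : WithTop ℚ) * S.v (aeval α (derivative f)) = ((15 : ℚ) : WithTop ℚ)} =
      162 := by
  have hw := S.extendsPadic_addValuation
  rw [← AddValuation.card_generatedField_nine hw]
  have hscale : ∀ x : WithTop ℚ, ((9 : ℚ) : WithTop ℚ) * x = ((15 : ℚ) : WithTop ℚ) ↔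
      x = ((15 / 9 : ℚ) : WithTop ℚ) := fun x => by
    induction x with
    | top => simp [WithTop.mul_top]
    | coe x =>
      rw [← WithTop.coe_mul, WithTop.coe_inj, WithTop.coe_inj, eq_div_iff (by norm_num), mul_comm]
  refine Nat.card_congr (Equiv.subtypeEquivRight fun L => ⟨?_, ?_⟩)
  · rintro ⟨f, ⟨hf, hfn, h1, h0⟩, α, hα, rfl, hder⟩
    have hα' := AddValuation.map_root_of_eisenstein (w := S.addValuation) (by norm_num) hf hfn h1 h0 hα
    obtain rfl := AddValuation.eq_minpoly_of_natDegree_eq hw hα' hf hfn hα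
    exact ⟨α, ⟨hα', hfn, (hscale _).1 hder⟩, rfl⟩
  · rintro ⟨α, hα, rfl⟩
    have hmonic := AddValuation.monic_minpoly (p := 3) α
    have hroot := minpoly.aeval ℚ_[3] α
    obtain ⟨h1, h0⟩ := AddValuation.coeff_of_isRoot hw (by norm_num) hmonic hα.natDegree_eq hroot
      hα.map_eq
    exact ⟨_, ⟨hmonic, hα.natDegree_eq, h1, h0⟩, α, hroot, rfl, (hscale _).2 hα.map_derivative_eq⟩
end

section
/- The number of distinct totally ramified extensions of Q_3 of degree 9 with discriminant (3)^{15} whose ramification polygon has vertices {(1,7), (9,0)} (i.e., consists of a single segment from (1,7) to (9,0)) is 54, and the number whose ramification polygon has vertices {(1,7), (3,3), (9,0)} is 108. -/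
open Polynomial

variable {p : ℕ} [Fact p.Prime] {K Ω : Type*} [Field K] [Field Ω]
    [Algebra ℚ_[p] K] [Algebra ℚ_[p] Ω] [Algebra K Ω] [IsScalarTower ℚ_[p] K Ω]

section NormBalls

/-- The `3`-adic number `c` is divisible by `3 ^ n` in `ℤ_[3]`. -/
def ThreePowDvd (n : ℕ) (c : ℚ_[3]) : Prop := ‖c‖ ≤ (3 : ℝ) ^ (-n : ℤ)

namespace ThreePowDvd

variable {n m : ℕ} {c d : ℚ_[3]}

lemma zero (n : ℕ) : ThreePowDvd n 0 := by
  simp only [ThreePowDvd, norm_zero]; positivity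

lemma add (hc : ThreePowDvd n c) (hd : ThreePowDvd n d) : ThreePowDvd n (c + d) :=
  (IsUltrametricDist.norm_add_le_max c d).trans (max_le hc hd)

lemma neg (hc : ThreePowDvd n c) : ThreePowDvd n (-c) := by
  simpa [ThreePowDvd] using hc

lemma sub (hc : ThreePowDvd n c) (hd : ThreePowDvd n d) : ThreePowDvd n (c - d) := by
  rw [sub_eq_add_neg]; exact hc.add hd.neg

lemma mul (hc : ThreePowDvd n c) (hd : ThreePowDvd m d) : ThreePowDvd (n + m) (c * d) := by
  unfold ThreePowDvd at *
  rw [norm_mul, show (-((n + m : ℕ) : ℤ)) = (-n : ℤ) + (-m : ℤ) by push_cast; ring,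
    zpow_add₀ (by norm_num)]
  exact mul_le_mul hc hd (norm_nonneg _) (by positivity)

lemma mono (hmn : m ≤ n) (hc : ThreePowDvd n c) : ThreePowDvd m c :=
  hc.trans (zpow_le_zpow_right₀ (by norm_num) (by omega))

lemma intCast_iff {k : ℤ} : ThreePowDvd n (k : ℚ_[3]) ↔ (3 : ℤ) ^ n ∣ k := by
  have := Padic.norm_int_le_pow_iff_dvd (p := 3) k n
  simpa [ThreePowDvd] using this

lemma natCast_iff {k : ℕ} : ThreePowDvd n (k : ℚ_[3]) ↔ 3 ^ n ∣ k := by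
  have := intCast_iff (n := n) (k := k)
  rw [Int.cast_natCast] at this
  rw [this]
  exact_mod_cast Int.natCast_dvd_natCast (m := 3 ^ n) (n := k)

lemma natCast_mul (k : ℕ) (hc : ThreePowDvd n c) : ThreePowDvd n ((k : ℚ_[3]) * c) := by
  have h : ThreePowDvd 0 (k : ℚ_[3]) := natCast_iff.2 (by simp)
  simpa using h.mul hc

lemma of_natCast_mul {k : ℕ} (hk : ¬ 3 ∣ k) (h : ThreePowDvd n ((k : ℚ_[3]) * c)) :
    ThreePowDvd n c := by
  have h1 : ‖(k : ℚ_[3])‖ = 1 := by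
    have h2 := (Padic.norm_intCast_eq_one_iff (p := 3) (z := k)).2
    rw [Int.cast_natCast] at h2
    apply h2
    exact Nat.isCoprime_iff_coprime.2 ((Nat.Prime.coprime_iff_not_dvd Nat.prime_three).2 hk).symm
  simpa [ThreePowDvd, norm_mul, h1] using h

/-- Every multiple of `3 ^ n` is congruent modulo `3 ^ (n + 1)` to one of `-3 ^ n, 0, 3 ^ n`. -/
lemma exists_digit (hc : ThreePowDvd n c) :
    ∃ k ∈ ({-1, 0, 1} : Finset ℤ), ThreePowDvd (n + 1) (c - (k * 3 ^ n : ℤ)) := by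
  have key : ∀ y : ℚ_[3], ThreePowDvd 0 y →
      ∃ k ∈ ({-1, 0, 1} : Finset ℤ), ThreePowDvd 1 (y - (k : ℤ)) := by
    intro y hy
    have hy1 : ‖y‖ ≤ 1 := by simpa [ThreePowDvd] using hy
    obtain ⟨Y, rfl⟩ : ∃ Y : ℤ_[3], (Y : ℚ_[3]) = y := ⟨⟨y, hy1⟩, rfl⟩
    have hlt := PadicInt.zmodRepr_lt_p Y
    have hmem := PadicInt.norm_sub_zmodRepr_lt_one Y
    generalize PadicInt.zmodRepr Y = r at hlt hmem
    have hr : ThreePowDvd 1 (Y - (r : ℤ)) := by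
      have h2 : ‖Y - (r : ℚ_[3])‖ < 1 := by
        rw [PadicInt.norm_def, PadicInt.coe_sub, PadicInt.coe_natCast] at hmem
        exact hmem
      have h3 := (Padic.norm_le_pow_iff_norm_lt_pow_add_one (p := 3) (Y - (r : ℚ_[3])) (-1)).2
        (by simpa using h2)
      simpa [ThreePowDvd] using h3
    have h3 : ThreePowDvd 1 ((3 : ℤ) : ℚ_[3]) := intCast_iff.2 (by norm_num)
    interval_cases r
    · exact ⟨0, by simp, by simpa using hr⟩
    · exact ⟨1, by simp, by simpa using hr⟩
    · refine ⟨-1, by simp, ?_⟩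
      convert hr.add h3 using 1
      push_cast; ring
  have h3 : ((3 : ℚ_[3]) ^ n) ≠ 0 := pow_ne_zero n (by norm_num)
  have hn : ‖(3 : ℚ_[3]) ^ n‖ = (3 : ℝ) ^ (-n : ℤ) := by
    simpa using Padic.norm_p_pow (p := 3) n
  have hinv : ThreePowDvd 0 (c / 3 ^ n) := by
    unfold ThreePowDvd at *
    rw [norm_div, hn]
    simpa using div_le_one_of_le₀ hc (by positivity)
  obtain ⟨k, hk, hk1⟩ := key _ hinv
  refine ⟨k, hk, ?_⟩
  have h4 : ThreePowDvd n ((3 : ℚ_[3]) ^ n) := hn.le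
  convert h4.mul hk1 using 1
  field_simp
  push_cast
  ring

end ThreePowDvd

end NormBalls

section Valuation

variable {E : Type*} [Field E] {v : AddValuation E (WithTop ℚ)}

lemma AddValuation.coe_le_mul {r s : ℚ} {x y : E} (hx : (r : WithTop ℚ) ≤ v x)
    (hy : (s : WithTop ℚ) ≤ v y) : ((r + s : ℚ) : WithTop ℚ) ≤ v (x * y) := by
  rw [v.map_mul, WithTop.coe_add]
  exact add_le_add hx hy

lemma AddValuation.map_pow_of_eq_s14 {q : ℚ} {x : E} (hx : v x = q) (n : ℕ) :
    v (x ^ n) = ((n * q : ℚ) : WithTop ℚ) := by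
  rw [v.map_pow, hx, ← WithTop.coe_nsmul, nsmul_eq_mul]

lemma AddValuation.map_prod' {ι : Type*} (s : Finset ι) (F : ι → E) :
    v (∏ i ∈ s, F i) = ∑ i ∈ s, v (F i) := by
  classical
  induction s using Finset.induction_on with
  | empty => simp
  | insert a s ha ih => rw [Finset.prod_insert ha, Finset.sum_insert ha, v.map_mul, ih]

lemma AddValuation.exists_coe {x : E} (hx : x ≠ 0) : ∃ q : ℚ, v x = q := by
  have := (v.ne_top_iff).2 hx
  obtain ⟨q, hq⟩ := WithTop.ne_top_iff_exists.1 this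
  exact ⟨q, hq.symm⟩

/-- A sum with a unique term of least valuation has the valuation of that term. -/
lemma AddValuation.map_sum_eq_of_lt' {ι : Type*} [DecidableEq ι] {s : Finset ι} {F : ι → E} {j : ι}
    (hj : j ∈ s) (hne : v (F j) ≠ ⊤) (h : ∀ i ∈ s, i ≠ j → v (F j) < v (F i)) :
    v (∑ i ∈ s, F i) = v (F j) := by
  rw [← Finset.add_sum_erase _ _ hj]
  refine v.map_add_eq_of_lt_left (v.map_lt_sum hne fun i hi => ?_)
  exact h i (Finset.mem_of_mem_erase hi) (Finset.ne_of_mem_erase hi)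

lemma AddValuation.sum_ne_zero_of_lt {ι : Type*} [DecidableEq ι] {s : Finset ι} {F : ι → E} {j : ι}
    (hj : j ∈ s) (hne : v (F j) ≠ ⊤) (h : ∀ i ∈ s, i ≠ j → v (F j) < v (F i)) :
    ∑ i ∈ s, F i ≠ 0 := by
  rw [← v.ne_top_iff, v.map_sum_eq_of_lt' hj hne h]
  exact hne

variable [Algebra ℚ_[3] E]

/-- The additive valuation `v` restricts to nine times the `3`-adic valuation on `ℚ_[3]`. -/
def IsNinePadic (v : AddValuation E (WithTop ℚ)) : Prop :=
  ∀ x : ℚ_[3], x ≠ 0 → v (algebraMap ℚ_[3] E x) = ((9 * x.valuation : ℚ) : WithTop ℚ)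

namespace IsNinePadic

lemma aeval_eq_sum {t : E} {p : ℚ_[3][X]} (hp : p.natDegree < 9) :
    aeval t p = ∑ j ∈ Finset.range 9, algebraMap ℚ_[3] E (p.coeff j) * t ^ j := by
  rw [aeval_eq_sum_range' hp]
  simp [Algebra.smul_def]

variable (hv : IsNinePadic v)
include hv

lemma coe_le_iff {n : ℕ} {c : ℚ_[3]} :
    ((9 * n : ℚ) : WithTop ℚ) ≤ v (algebraMap ℚ_[3] E c) ↔ ThreePowDvd n c := by
  rcases eq_or_ne c 0 with rfl | hc
  · simp [ThreePowDvd.zero]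
  · rw [hv c hc, WithTop.coe_le_coe, ThreePowDvd, Padic.norm_eq_zpow_neg_valuation hc]
    rw [show ((3 : ℕ) : ℝ) = 3 by norm_num, zpow_le_zpow_iff_right₀ (by norm_num), neg_le_neg_iff]
    rw [mul_le_mul_iff_right₀ (by norm_num)]
    exact_mod_cast Iff.rfl

lemma le_of_dvd {n : ℕ} {c : ℚ_[3]} (hc : ThreePowDvd n c) :
    ((9 * n : ℚ) : WithTop ℚ) ≤ v (algebraMap ℚ_[3] E c) := hv.coe_le_iff.2 hc

lemma dvd_of_lt {n : ℕ} {c : ℚ_[3]} {r : ℚ} (hr : 9 * ((n : ℚ) - 1) ≤ r)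
    (h : (r : WithTop ℚ) < v (algebraMap ℚ_[3] E c)) :
    ThreePowDvd n c := by
  rw [← hv.coe_le_iff]
  rcases eq_or_ne c 0 with rfl | hc
  · simp
  · rw [hv c hc] at h ⊢
    have h1 := WithTop.coe_lt_coe.1 h
    apply WithTop.coe_le_coe.2
    have h2 : (n : ℚ) - 1 < c.valuation := by linarith
    have h3 : (n : ℤ) - 1 < c.valuation := by exact_mod_cast h2
    have h4 : (n : ℚ) ≤ c.valuation := by exact_mod_cast (by omega : (n : ℤ) ≤ c.valuation)
    linarith

lemma eq_of_dvd {n : ℕ} {c : ℚ_[3]} (h1 : ThreePowDvd n c) (h2 : ¬ ThreePowDvd (n + 1) c) :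
    v (algebraMap ℚ_[3] E c) = ((9 * n : ℚ) : WithTop ℚ) := by
  refine le_antisymm (not_lt.1 fun h => h2 (hv.dvd_of_lt ?_ h)) (hv.le_of_dvd h1)
  push_cast; linarith

lemma le_term {n i : ℕ} {c : ℚ_[3]} {t : E} (ht : v t = 1) {r : ℚ} (hc : ThreePowDvd n c)
    (hr : r ≤ 9 * n + i) : (r : WithTop ℚ) ≤ v (algebraMap ℚ_[3] E c * t ^ i) := by
  have h1 : (i : ℚ) ≤ v (t ^ i) := by
    rw [AddValuation.map_pow_of_eq_s14 (q := 1) ht i]; simp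
  exact (WithTop.coe_le_coe.2 hr).trans (AddValuation.coe_le_mul (hv.le_of_dvd hc) h1)

lemma dvd_of_lt_term {n i : ℕ} {c : ℚ_[3]} {t : E} (ht : v t = 1) {r : ℚ}
    (hr : 9 * ((n : ℚ) - 1) + i ≤ r) (h : (r : WithTop ℚ) < v (algebraMap ℚ_[3] E c * t ^ i)) :
    ThreePowDvd n c := by
  apply hv.dvd_of_lt (r := r - i) (by linarith)
  rw [v.map_mul, AddValuation.map_pow_of_eq_s14 (q := 1) ht i] at h
  rcases eq_or_ne c 0 with rfl | hc
  · rw [map_zero, v.map_zero]; exact WithTop.coe_lt_top _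
  · rw [hv c hc, ← WithTop.coe_add, WithTop.coe_lt_coe] at h
    rw [hv c hc, WithTop.coe_lt_coe]
    linarith

/-- Terms `a i * t ^ i` with `i < 9` have pairwise distinct valuations when `v t = 1`, so that
none of them is smaller than their sum. -/
lemma sum_le_term {t : E} (ht : v t = 1) (a : ℕ → ℚ_[3]) {i : ℕ} (hi : i < 9) :
    v (∑ j ∈ Finset.range 9, algebraMap ℚ_[3] E (a j) * t ^ j) ≤
      v (algebraMap ℚ_[3] E (a i) * t ^ i) := by
  obtain ⟨m, hm, hmin⟩ := Finset.exists_min_image (Finset.range 9)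
    (fun j => v (algebraMap ℚ_[3] E (a j) * t ^ j)) ⟨0, by simp⟩
  by_cases htop : v (algebraMap ℚ_[3] E (a m) * t ^ m) = ⊤
  · have := hmin i (Finset.mem_range.2 hi)
    rw [htop, top_le_iff] at this
    rw [this]; exact le_top
  · rw [AddValuation.map_sum_eq_of_lt' hm htop]
    · exact hmin i (Finset.mem_range.2 hi)
    · intro j hj hjm
      refine lt_of_le_of_ne (hmin j hj) fun heq => hjm ?_
      have ham : a m ≠ 0 := by rintro h; simp [h] at htop
      have haj : a j ≠ 0 := by rintro h; rw [heq] at htop; simp [h] at htop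
      rw [v.map_mul, v.map_mul, AddValuation.map_pow_of_eq_s14 (q := 1) ht,
        AddValuation.map_pow_of_eq_s14 (q := 1) ht, hv _ ham, hv _ haj, ← WithTop.coe_add,
        ← WithTop.coe_add, WithTop.coe_inj] at heq
      have h2 : 9 * (a m).valuation + m * 1 = 9 * (a j).valuation + j * 1 := by exact_mod_cast heq
      simp only [Finset.mem_range] at hm hj
      omega

lemma dvd_of_lt_sum {t : E} (ht : v t = 1) (a : ℕ → ℚ_[3]) {r : ℚ}
    (h : (r : WithTop ℚ) < v (∑ j ∈ Finset.range 9, algebraMap ℚ_[3] E (a j) * t ^ j))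
    {i : ℕ} (hi : i < 9) (n : ℕ) (hr : 9 * ((n : ℚ) - 1) + i ≤ r) : ThreePowDvd n (a i) :=
  hv.dvd_of_lt_term ht hr (h.trans_le (hv.sum_le_term ht a hi))

lemma dvd_coeff_of_lt {t : E} (ht : v t = 1) {p : ℚ_[3][X]} (hp : p.natDegree < 9) {r : ℚ}
    (h : (r : WithTop ℚ) < v (aeval t p)) {i : ℕ} (hi : i < 9) (n : ℕ)
    (hr : 9 * ((n : ℚ) - 1) + i ≤ r) : ThreePowDvd n (p.coeff i) := by
  rw [aeval_eq_sum hp] at h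
  exact hv.dvd_of_lt_sum ht _ h hi n hr

lemma le_aeval {t : E} (ht : v t = 1) {p : ℚ_[3][X]} (hp : p.natDegree < 9) {r : ℚ}
    (h : ∀ i < 9, ∃ n : ℕ, ThreePowDvd n (p.coeff i) ∧ r ≤ 9 * n + i) :
    (r : WithTop ℚ) ≤ v (aeval t p) := by
  rw [aeval_eq_sum hp]
  refine v.map_le_sum fun i hi => ?_
  obtain ⟨n, hn, hr⟩ := h i (Finset.mem_range.1 hi)
  exact hv.le_term ht hn hr

lemma nine_le_natDegree_minpoly [Algebra.IsAlgebraic ℚ_[3] E] {t : E} (ht : v t = 1) :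
    9 ≤ (minpoly ℚ_[3] t).natDegree := by
  by_contra hlt
  have hlt := not_le.1 hlt
  have h_int : IsIntegral ℚ_[3] t := Algebra.IsIntegral.isIntegral t
  have h := hv.dvd_coeff_of_lt ht hlt (r := 9 * ((1 : ℕ) - 1) + (minpoly ℚ_[3] t).natDegree)
    (by rw [minpoly.aeval, v.map_zero]; exact WithTop.coe_lt_top _) hlt 1 le_rfl
  rw [(minpoly.monic h_int).coeff_natDegree] at h
  have := ThreePowDvd.natCast_iff (n := 1) (k := 1)
  simp at this
  exact this h

end IsNinePadic

end Valuation

section Eisenstein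

/-- Eisenstein polynomials of degree nine over `ℚ_[3]`. -/
structure IsEisensteinNine (f : ℚ_[3][X]) : Prop where
  monic : f.Monic
  natDegree_eq : f.natDegree = 9
  dvd_coeff : ∀ i < 9, ThreePowDvd 1 (f.coeff i)
  coeff_zero : ¬ ThreePowDvd 2 (f.coeff 0)

/-- Eisenstein polynomials of degree nine over `ℚ_[3]` whose discriminant has valuation `15`;
the parameter `b` tells whether the ramification polygon consists of a single segment. -/
structure HasDiscFifteen (b : Bool) (f : ℚ_[3][X]) : Prop extends IsEisensteinNine f where
  coeff_seven : ¬ ThreePowDvd 2 (f.coeff 7)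
  coeff_one : ThreePowDvd 2 (f.coeff 1)
  coeff_two : ThreePowDvd 2 (f.coeff 2)
  coeff_four : ThreePowDvd 2 (f.coeff 4)
  coeff_five : ThreePowDvd 2 (f.coeff 5)
  coeff_three : ThreePowDvd 2 (f.coeff 3) ↔ b = true

variable {E : Type*} [Field E] [Algebra ℚ_[3] E] {v : AddValuation E (WithTop ℚ)}
  {f : ℚ_[3][X]} {b : Bool} {α : E}

lemma IsEisensteinNine.coeff_nine (hf : IsEisensteinNine f) : f.coeff 9 = 1 := by
  have := hf.monic.coeff_natDegree
  rwa [hf.natDegree_eq] at this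

lemma IsEisensteinNine.natDegree_sub_lt {g : ℚ_[3][X]} (hf : IsEisensteinNine f)
    (hg : IsEisensteinNine g) : (f - g).natDegree < 9 := by
  have hle : (f - g).natDegree ≤ 9 :=
    (natDegree_sub_le _ _).trans (by rw [hf.natDegree_eq, hg.natDegree_eq, max_self])
  refine lt_of_le_of_ne hle fun h => ?_
  have h0 : (f - g).coeff 9 = 0 := by rw [coeff_sub, hf.coeff_nine, hg.coeff_nine, sub_self]
  have h1 := leadingCoeff_eq_zero.1 (by rw [leadingCoeff, h, h0] : (f - g).leadingCoeff = 0)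
  simp [h1] at h

lemma aeval_eq_sum_add_pow (hm : f.Monic) (hd : f.natDegree = 9) (t : E) :
    aeval t f = ∑ j ∈ Finset.range 9, algebraMap ℚ_[3] E (f.coeff j) * t ^ j + t ^ 9 := by
  have := hm.coeff_natDegree
  rw [hd] at this
  rw [aeval_eq_sum_range' (n := 10) (by omega), Finset.sum_range_succ, this]
  simp [Algebra.smul_def]

lemma IsEisensteinNine.val_root (hf : IsEisensteinNine f) (hv : IsNinePadic v)
    (h0 : aeval α f = 0) : v α = 1 := by
  rw [aeval_eq_sum_add_pow hf.monic hf.natDegree_eq] at h0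
  have hne : α ≠ 0 := by
    rintro rfl
    have h1 : algebraMap ℚ_[3] E (f.coeff 0) = 0 := by
      simpa [Finset.sum_range_succ'] using h0
    rw [map_eq_zero] at h1
    exact hf.coeff_zero (h1 ▸ ThreePowDvd.zero 2)
  obtain ⟨q, hq⟩ := v.exists_coe hne
  have hsum : v (∑ j ∈ Finset.range 9, algebraMap ℚ_[3] E (f.coeff j) * α ^ j) =
      ((9 * q : ℚ) : WithTop ℚ) := by
    rw [eq_neg_of_add_eq_zero_left h0, v.map_neg, v.map_pow_of_eq_s14 hq]; norm_num
  have hterm : ∀ j : ℕ, j < 9 → ((9 + j * q : ℚ) : WithTop ℚ) ≤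
      v (algebraMap ℚ_[3] E (f.coeff j) * α ^ j) := fun j hj =>
    AddValuation.coe_le_mul (by simpa using hv.le_of_dvd (hf.dvd_coeff j hj))
      (v.map_pow_of_eq_s14 hq j).ge
  have hzero : v (algebraMap ℚ_[3] E (f.coeff 0)) = ((9 : ℚ) : WithTop ℚ) := by
    simpa using hv.eq_of_dvd (hf.dvd_coeff 0 (by norm_num)) hf.coeff_zero
  rcases le_or_gt q 0 with hq0 | hq0
  · exfalso
    refine (v.map_lt_sum (WithTop.coe_ne_top (a := 9 * q)) fun j hj => ?_).ne' hsum
    have hj := Finset.mem_range.1 hj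
    refine lt_of_lt_of_le (WithTop.coe_lt_coe.2 ?_) (hterm j hj)
    have hj' : (j : ℚ) ≤ 9 := by exact_mod_cast hj.le
    nlinarith
  · rw [AddValuation.map_sum_eq_of_lt' (j := 0) (by simp)] at hsum
    · rw [pow_zero, mul_one, hzero, WithTop.coe_inj] at hsum
      rw [hq, show q = 1 by linarith]; rfl
    · rw [pow_zero, mul_one, hzero]; exact WithTop.coe_ne_top
    · intro j hj hj0
      refine lt_of_lt_of_le ?_ (hterm j (Finset.mem_range.1 hj))
      rw [pow_zero, mul_one, hzero]
      refine WithTop.coe_lt_coe.2 ?_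
      have : (0 : ℚ) < j := by exact_mod_cast Nat.pos_of_ne_zero hj0
      nlinarith

lemma IsEisensteinNine.eq_minpoly [Algebra.IsAlgebraic ℚ_[3] E] (hf : IsEisensteinNine f)
    (hv : IsNinePadic v) (h0 : aeval α f = 0) : minpoly ℚ_[3] α = f := by
  have h_int : IsIntegral ℚ_[3] α := Algebra.IsIntegral.isIntegral α
  refine (eq_of_monic_of_dvd_of_natDegree_le (minpoly.monic h_int) hf.monic
    (minpoly.dvd _ _ h0) ?_).symm
  rw [hf.natDegree_eq]
  exact hv.nine_le_natDegree_minpoly (hf.val_root hv h0)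

lemma IsNinePadic.isEisensteinNine_minpoly [Algebra.IsAlgebraic ℚ_[3] E] (hv : IsNinePadic v)
    {t : E} (ht : v t = 1) (hd : (minpoly ℚ_[3] t).natDegree = 9) :
    IsEisensteinNine (minpoly ℚ_[3] t) := by
  have hm := minpoly.monic (Algebra.IsIntegral.isIntegral (R := ℚ_[3]) t)
  have h0 := minpoly.aeval ℚ_[3] t
  rw [aeval_eq_sum_add_pow hm hd] at h0
  have hsum : v (∑ j ∈ Finset.range 9, algebraMap ℚ_[3] E ((minpoly ℚ_[3] t).coeff j) * t ^ j) =
      ((9 : ℚ) : WithTop ℚ) := by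
    rw [eq_neg_of_add_eq_zero_left h0, v.map_neg, v.map_pow_of_eq_s14 (q := 1) ht]; norm_num
  have hdvd : ∀ i < 9, ThreePowDvd 1 ((minpoly ℚ_[3] t).coeff i) := by
    intro i hi
    refine hv.dvd_of_lt_sum ht _ (r := i) ?_ hi 1 (by norm_num)
    rw [hsum]
    exact WithTop.coe_lt_coe.2 (by exact_mod_cast hi)
  refine ⟨hm, hd, hdvd, fun h => ?_⟩
  refine (v.map_lt_sum (WithTop.coe_ne_top (a := (9 : ℚ))) fun j hj => ?_).ne' hsum
  have hj := Finset.mem_range.1 hj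
  refine lt_of_lt_of_le (WithTop.coe_lt_coe.2 (by norm_num : (9 : ℚ) < 10)) ?_
  rcases Nat.eq_zero_or_pos j with rfl | hj0
  · exact hv.le_term ht h (by norm_num)
  · refine hv.le_term ht (hdvd j hj) ?_
    have : (1 : ℚ) ≤ j := by exact_mod_cast hj0
    push_cast; linarith

lemma IsEisensteinNine.natDegree_derivative_lt (hf : IsEisensteinNine f) :
    (derivative f).natDegree < 9 := by
  have := Polynomial.natDegree_derivative_lt (p := f) (by rw [hf.natDegree_eq]; norm_num)
  rwa [hf.natDegree_eq] at this

lemma threePowDvd_coeff_derivative {n i : ℕ} (h : ThreePowDvd n (f.coeff (i + 1))) :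
    ThreePowDvd n ((derivative f).coeff i) := by
  rw [coeff_derivative, mul_comm]
  exact_mod_cast h.natCast_mul (i + 1)

lemma threePowDvd_coeff_derivative_iff {n i : ℕ} (hi : ¬ 3 ∣ i + 1) :
    ThreePowDvd n ((derivative f).coeff i) ↔ ThreePowDvd n (f.coeff (i + 1)) := by
  refine ⟨fun h => ThreePowDvd.of_natCast_mul hi ?_, threePowDvd_coeff_derivative⟩
  rw [coeff_derivative, mul_comm] at h
  exact_mod_cast h

lemma IsEisensteinNine.dvd_coeff_derivative (hf : IsEisensteinNine f) {i : ℕ} (hi : i < 9)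
    (h3 : 3 ∣ i + 1) : ThreePowDvd 2 ((derivative f).coeff i) := by
  rw [coeff_derivative, mul_comm]
  rcases eq_or_ne i 8 with rfl | h8
  · rw [hf.coeff_nine, mul_one]
    exact_mod_cast (ThreePowDvd.natCast_iff (n := 2) (k := 8 + 1)).2 (by norm_num)
  · have h4 : ThreePowDvd 1 ((i + 1 : ℕ) : ℚ_[3]) := ThreePowDvd.natCast_iff.2 (by simpa using h3)
    exact_mod_cast h4.mul (hf.dvd_coeff (i + 1) (by omega))

lemma IsEisensteinNine.le_val_derivative (hf : IsEisensteinNine f) (hv : IsNinePadic v)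
    (hα : v α = 1) {n : ℕ} (h1 : ThreePowDvd 2 (f.coeff 1)) (h2 : ThreePowDvd 2 (f.coeff 2))
    (h4 : ThreePowDvd 2 (f.coeff 4)) (h5 : ThreePowDvd 2 (f.coeff 5))
    (h7 : ThreePowDvd n (f.coeff 7)) {r : ℚ} (hr : r ≤ 16) (hn : r ≤ 9 * n + 6) :
    (r : WithTop ℚ) ≤ v (aeval α (derivative f)) := by
  refine hv.le_aeval hα hf.natDegree_derivative_lt fun i hi => ?_
  have h3 := fun h => hf.dvd_coeff_derivative hi h
  interval_cases i
  · exact ⟨2, threePowDvd_coeff_derivative h1, by push_cast; linarith⟩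
  · exact ⟨2, threePowDvd_coeff_derivative h2, by push_cast; linarith⟩
  · exact ⟨2, h3 (by norm_num), by push_cast; linarith⟩
  · exact ⟨2, threePowDvd_coeff_derivative h4, by push_cast; linarith⟩
  · exact ⟨2, threePowDvd_coeff_derivative h5, by push_cast; linarith⟩
  · exact ⟨2, h3 (by norm_num), by push_cast; linarith⟩
  · exact ⟨n, threePowDvd_coeff_derivative h7, by push_cast; linarith⟩
  · exact ⟨1, threePowDvd_coeff_derivative (hf.dvd_coeff 8 (by norm_num)), by push_cast; linarith⟩
  · exact ⟨2, h3 (by norm_num), by push_cast; linarith⟩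

lemma HasDiscFifteen.val_derivative (hf : HasDiscFifteen b f) (hv : IsNinePadic v)
    (hα : v α = 1) : v (aeval α (derivative f)) = ((15 : ℚ) : WithTop ℚ) := by
  refine le_antisymm (not_lt.1 fun h => hf.coeff_seven ?_) ?_
  · rw [← threePowDvd_coeff_derivative_iff (by norm_num)]
    exact hv.dvd_coeff_of_lt hα hf.natDegree_derivative_lt h (by norm_num) 2 (by norm_num)
  · exact hf.le_val_derivative hv hα hf.coeff_one hf.coeff_two hf.coeff_four hf.coeff_five
      (hf.dvd_coeff 7 (by norm_num)) (by norm_num) (by norm_num)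

open Classical in
lemma IsEisensteinNine.hasDiscFifteen (hf : IsEisensteinNine f) (hv : IsNinePadic v)
    (hα : v α = 1) (h : v (aeval α (derivative f)) = ((15 : ℚ) : WithTop ℚ)) :
    HasDiscFifteen (decide (ThreePowDvd 2 (f.coeff 3))) f := by
  have key : ∀ i < 6, ¬ 3 ∣ i + 1 → ThreePowDvd 2 (f.coeff (i + 1)) := by
    intro i hi h3
    rw [← threePowDvd_coeff_derivative_iff h3]
    refine hv.dvd_coeff_of_lt hα hf.natDegree_derivative_lt (r := 14) ?_ (by omega) 2 ?_
    · rw [h]; exact WithTop.coe_lt_coe.2 (by norm_num)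
    · have : (i : ℚ) ≤ 5 := by exact_mod_cast Nat.le_of_lt_succ hi
      push_cast; linarith
  have h1 := key 0 (by norm_num) (by norm_num)
  have h2 := key 1 (by norm_num) (by norm_num)
  have h4 := key 3 (by norm_num) (by norm_num)
  have h5 := key 4 (by norm_num) (by norm_num)
  refine ⟨hf, fun h7 => ?_, h1, h2, h4, h5, by simp⟩
  have := hf.le_val_derivative hv hα h1 h2 h4 h5 h7 (r := 16) le_rfl (by norm_num)
  rw [h, WithTop.coe_le_coe] at this
  norm_num at this

end Eisenstein

section RamificationPolynomial

variable {E : Type*} [Field E] [Algebra ℚ_[3] E] {v : AddValuation E (WithTop ℚ)}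
  {f : ℚ_[3][X]} {b : Bool} {α β : E}

/-- The coefficients of the ramification polynomial `f (α x + α) / α ^ 9`. -/
noncomputable def ramCoeff (f : ℚ_[3][X]) (α : E) (i : ℕ) : E :=
  ∑ k ∈ Finset.Icc i 9, (k.choose i : E) * algebraMap ℚ_[3] E (f.coeff k) * α ^ ((k : ℤ) - 9)

lemma ramCoeff_mul_pow (hα : α ≠ 0) (f : ℚ_[3][X]) (i : ℕ) :
    ramCoeff f α i * α ^ 9 =
      ∑ k ∈ Finset.range 10, algebraMap ℚ_[3] E (k.choose i * f.coeff k) * α ^ k := by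
  rw [ramCoeff, Finset.sum_mul]
  refine (Finset.sum_congr rfl fun k _ => ?_).trans
    (Finset.sum_subset (s₁ := Finset.Icc i 9) (fun k hk => ?_) fun k hk hk' => ?_)
  · rw [zpow_sub₀ hα, map_mul, map_natCast]
    have h9 : α ^ (9 : ℤ) = α ^ 9 := by norm_cast
    rw [h9, zpow_natCast]
    field_simp
  · simp only [Finset.mem_Icc] at hk
    simp only [Finset.mem_range]; omega
  · simp only [Finset.mem_Icc, Finset.mem_range] at hk hk'
    rw [Nat.choose_eq_zero_of_lt (by omega)]
    simp

lemma taylor_coeff_mul_pow (hf : f.natDegree = 9) (α : E) (i : ℕ) :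
    (taylor α (f.map (algebraMap ℚ_[3] E))).coeff i * α ^ i =
      ∑ k ∈ Finset.range 10, algebraMap ℚ_[3] E (k.choose i * f.coeff k) * α ^ k := by
  have hd : (f.map (algebraMap ℚ_[3] E)).natDegree < 10 := by
    rw [natDegree_map, hf]; norm_num
  rw [taylor_coeff, hasseDeriv_apply, sum_over_range' _ (by simp) 10 hd, eval_finsetSum,
    Finset.sum_mul]
  refine Finset.sum_congr rfl fun k _ => ?_
  rw [eval_monomial, coeff_map, map_mul, map_natCast]
  rcases le_or_gt i k with h | h
  · rw [mul_assoc, ← pow_add, Nat.sub_add_cancel h]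
  · rw [Nat.choose_eq_zero_of_lt h]; simp

lemma ramCoeff_mul_pow_eq_taylor (hf : f.natDegree = 9) (hα : α ≠ 0) (i : ℕ) :
    ramCoeff f α i * α ^ 9 = (taylor α (f.map (algebraMap ℚ_[3] E))).coeff i * α ^ i := by
  rw [ramCoeff_mul_pow hα, taylor_coeff_mul_pow hf]

lemma ramCoeff_one_mul_pow (hf : f.natDegree = 9) (hα : α ≠ 0) :
    ramCoeff f α 1 * α ^ 8 = aeval α (derivative f) := by
  have h := ramCoeff_mul_pow_eq_taylor hf hα 1
  rw [taylor_coeff_one, derivative_map, eval_map_algebraMap, pow_one] at h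
  refine mul_right_cancel₀ hα ?_
  rw [← h]; ring

/-- The quotients `(β - α) / α` for roots `β ≠ α` are roots of the ramification polynomial. -/
lemma sum_ramCoeff_mul_pow (hf : f.natDegree = 9) (hα : α ≠ 0) (h0 : aeval α f = 0)
    (h1 : aeval β f = 0) : ∑ i ∈ Finset.Icc 1 9, ramCoeff f α i * ((β - α) / α) ^ i = 0 := by
  have hd : (taylor α (f.map (algebraMap ℚ_[3] E))).natDegree < 10 := by
    rw [natDegree_taylor, natDegree_map, hf]; norm_num
  have h2 := taylor_eval_sub (f := f.map (algebraMap ℚ_[3] E)) (r := α) β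
  rw [eval_eq_sum_range' hd, eval_map_algebraMap, h1, Finset.sum_range_succ', taylor_coeff_zero,
    eval_map_algebraMap, h0, zero_mul, add_zero] at h2
  have h9 : α ^ 9 ≠ 0 := pow_ne_zero _ hα
  refine mul_right_cancel₀ h9 ?_
  rw [zero_mul, ← h2, Finset.sum_mul, Finset.range_eq_Ico, Finset.sum_Ico_add'
    (fun i => (taylor α (f.map (algebraMap ℚ_[3] E))).coeff i * (β - α) ^ i) 0 9 1]
  refine Finset.sum_congr rfl fun i _ => ?_
  rw [mul_right_comm, ramCoeff_mul_pow_eq_taylor hf hα, div_pow]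
  field_simp

namespace HasDiscFifteen

variable (hf : HasDiscFifteen b f) (hv : IsNinePadic v) (hα : v α = 1)
include hf hv hα

lemma le_val_ramCoeff {i n₃ n₆ n₉ : ℕ} {r : ℚ} (hi : 1 ≤ i)
    (h3 : ThreePowDvd n₃ ((3 : ℕ).choose i * f.coeff 3))
    (h6 : ThreePowDvd n₆ ((6 : ℕ).choose i * f.coeff 6))
    (h9 : 3 ^ n₉ ∣ (9 : ℕ).choose i) (hr : r ≤ 7) (hr3 : r + 6 ≤ 9 * n₃) (hr6 : r + 3 ≤ 9 * n₆)
    (hr9 : r ≤ 9 * n₉) : (r : WithTop ℚ) ≤ v (ramCoeff f α i) := by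
  have hα0 : α ≠ 0 := by rintro rfl; simp at hα
  have key : ((r + 9 : ℚ) : WithTop ℚ) ≤ v (ramCoeff f α i * α ^ 9) := by
    rw [ramCoeff_mul_pow hα0]
    refine v.map_le_sum fun k hk => ?_
    have hk := Finset.mem_range.1 hk
    interval_cases k
    · rw [Nat.choose_eq_zero_of_lt (by omega)]; simp
    · exact hv.le_term hα (hf.coeff_one.natCast_mul _) (by push_cast; linarith)
    · exact hv.le_term hα (hf.coeff_two.natCast_mul _) (by push_cast; linarith)
    · exact hv.le_term hα h3 (by push_cast; linarith)
    · exact hv.le_term hα (hf.coeff_four.natCast_mul _) (by push_cast; linarith)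
    · exact hv.le_term hα (hf.coeff_five.natCast_mul _) (by push_cast; linarith)
    · exact hv.le_term hα h6 (by push_cast; linarith)
    · exact hv.le_term hα ((hf.dvd_coeff 7 (by norm_num)).natCast_mul _) (by push_cast; linarith)
    · exact hv.le_term hα ((hf.dvd_coeff 8 (by norm_num)).natCast_mul _) (by push_cast; linarith)
    · rw [hf.coeff_nine, mul_one]
      exact hv.le_term hα (ThreePowDvd.natCast_iff.2 h9) (by push_cast; linarith)
  rw [v.map_mul, AddValuation.map_pow_of_eq_s14 (q := 1) hα, WithTop.coe_add] at key
  norm_num at key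
  exact key

lemma val_ramCoeff_one : v (ramCoeff f α 1) = ((7 : ℚ) : WithTop ℚ) := by
  have hα0 : α ≠ 0 := by rintro rfl; simp at hα
  have h := hf.val_derivative hv hα
  rw [← ramCoeff_one_mul_pow hf.natDegree_eq hα0, v.map_mul,
    AddValuation.map_pow_of_eq_s14 (q := 1) hα, show ((15 : ℚ) : WithTop ℚ) = ((7 : ℚ) : WithTop ℚ) +
    (((8 : ℕ) * 1 : ℚ) : WithTop ℚ) by rw [← WithTop.coe_add]; norm_num] at h
  exact (WithTop.add_right_inj WithTop.coe_ne_top).1 h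

omit hv hα in
lemma val_ramCoeff_nine : v (ramCoeff f α 9) = ((0 : ℚ) : WithTop ℚ) := by
  simp [ramCoeff, hf.coeff_nine]

lemma le_val_ramCoeff_two : ((7 : ℚ) : WithTop ℚ) ≤ v (ramCoeff f α 2) := by
  refine hf.le_val_ramCoeff hv hα (n₃ := 2) (n₆ := 2) (n₉ := 2) (by norm_num) ?_ ?_
    (by decide) le_rfl (by norm_num) (by norm_num) (by norm_num)
  · exact (ThreePowDvd.natCast_iff (n := 1).2 (by decide)).mul (hf.dvd_coeff 3 (by norm_num))
  · exact (ThreePowDvd.natCast_iff (n := 1).2 (by decide)).mul (hf.dvd_coeff 6 (by norm_num))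

lemma le_val_ramCoeff_three : ((3 : ℚ) : WithTop ℚ) ≤ v (ramCoeff f α 3) := by
  refine hf.le_val_ramCoeff hv hα (n₃ := 1) (n₆ := 1) (n₉ := 1) (by norm_num) ?_ ?_
    (by decide) (by norm_num) (by norm_num) (by norm_num) (by norm_num)
  · exact (hf.dvd_coeff 3 (by norm_num)).natCast_mul _
  · exact (hf.dvd_coeff 6 (by norm_num)).natCast_mul _

lemma le_val_ramCoeff_three_of_eq_true (hb : b = true) :
    ((6 : ℚ) : WithTop ℚ) ≤ v (ramCoeff f α 3) := by
  refine hf.le_val_ramCoeff hv hα (n₃ := 2) (n₆ := 1) (n₉ := 1) (by norm_num) ?_ ?_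
    (by decide) (by norm_num) (by norm_num) (by norm_num) (by norm_num)
  · exact (hf.coeff_three.2 hb).natCast_mul _
  · exact (hf.dvd_coeff 6 (by norm_num)).natCast_mul _

lemma eq_true_of_lt_val_ramCoeff_three (h : ((3 : ℚ) : WithTop ℚ) < v (ramCoeff f α 3)) :
    b = true := by
  have hα0 : α ≠ 0 := by rintro rfl; simp at hα
  have key : ((12 : ℚ) : WithTop ℚ) < v (ramCoeff f α 3 * α ^ 9) := by
    rw [v.map_mul, AddValuation.map_pow_of_eq_s14 (q := 1) hα]
    rw [show ((12 : ℚ) : WithTop ℚ) = ((3 : ℚ) : WithTop ℚ) +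
      (((9 : ℕ) * 1 : ℚ) : WithTop ℚ) by rw [← WithTop.coe_add]; norm_num]
    exact WithTop.add_lt_add_right WithTop.coe_ne_top h
  have h9 : ((18 : ℚ) : WithTop ℚ) ≤
      v (algebraMap ℚ_[3] E ((9 : ℕ).choose 3 * f.coeff 9) * α ^ 9) := by
    rw [hf.coeff_nine, mul_one]
    exact hv.le_term hα (ThreePowDvd.natCast_iff (n := 1).2 (by decide)) (by norm_num)
  rw [ramCoeff_mul_pow hα0, Finset.sum_range_succ] at key
  have h12 : ((12 : ℚ) : WithTop ℚ) < ((18 : ℚ) : WithTop ℚ) := WithTop.coe_lt_coe.2 (by norm_num)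
  have key2 := v.map_lt_add key (by rw [v.map_neg]; exact h12.trans_le h9)
  rw [add_neg_cancel_right] at key2
  have := hv.dvd_of_lt_sum hα _ key2 (i := 3) (by norm_num) 2 (by norm_num)
  rw [← hf.coeff_three]
  simpa using this

lemma le_val_ramCoeff_of_four_le {i : ℕ} (hi : 4 ≤ i) (hi' : i ≤ 8) :
    ((6 : ℚ) : WithTop ℚ) ≤ v (ramCoeff f α i) := by
  refine hf.le_val_ramCoeff hv hα (n₃ := 2) (n₆ := 1) (n₉ := 1) (by omega) ?_ ?_
    ?_ (by norm_num) (by norm_num) (by norm_num) (by norm_num)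
  · rw [Nat.choose_eq_zero_of_lt (by omega)]
    simpa using ThreePowDvd.zero 2
  · exact (hf.dvd_coeff 6 (by norm_num)).natCast_mul _
  · interval_cases i <;> decide

end HasDiscFifteen

end RamificationPolynomial

section Roots

variable {E : Type*} [Field E] [Algebra ℚ_[3] E] {v : AddValuation E (WithTop ℚ)}
  {f g : ℚ_[3][X]} {b c : Bool} {α β : E}

/-- Lower bounds for the valuations of the coefficients of the ramification polynomial. -/
def ramBound (b : Bool) : ℕ → ℚ
  | 1 => 7
  | 2 => 7
  | 3 => if b then 6 else 3
  | 9 => 0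
  | _ => 6

lemma HasDiscFifteen.ramBound_le (hf : HasDiscFifteen b f) (hv : IsNinePadic v) (hα : v α = 1)
    {i : ℕ} (hi : i ∈ Finset.Icc 1 9) : (ramBound b i : WithTop ℚ) ≤ v (ramCoeff f α i) := by
  obtain ⟨h1, h9⟩ := Finset.mem_Icc.1 hi
  interval_cases i
  · exact (hf.val_ramCoeff_one hv hα).ge
  · exact hf.le_val_ramCoeff_two hv hα
  · cases b
    · exact hf.le_val_ramCoeff_three hv hα
    · exact hf.le_val_ramCoeff_three_of_eq_true hv hα rfl
  any_goals exact hf.le_val_ramCoeff_of_four_le hv hα (by norm_num) (by norm_num)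
  exact hf.val_ramCoeff_nine.ge

lemma HasDiscFifteen.val_ramCoeff_three (hf : HasDiscFifteen false f) (hv : IsNinePadic v)
    (hα : v α = 1) : v (ramCoeff f α 3) = ((3 : ℚ) : WithTop ℚ) :=
  le_antisymm (not_lt.1 fun h => by simpa using hf.eq_true_of_lt_val_ramCoeff_three hv hα h)
    (hf.le_val_ramCoeff_three hv hα)

lemma HasDiscFifteen.exists_ramBound_le (hf : HasDiscFifteen b f) (hv : IsNinePadic v)
    (h0 : aeval α f = 0) (h1 : aeval β f = 0) {q : ℚ} (hq : v ((β - α) / α) = q) {j : ℕ}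
    (hj : j ∈ Finset.Icc 1 9) (hRj : v (ramCoeff f α j) = ramBound b j) :
    ∃ i, 1 ≤ i ∧ i ≤ 9 ∧ i ≠ j ∧ ramBound b i + i * q ≤ ramBound b j + j * q := by
  by_contra! hcon
  have hα := hf.val_root hv h0
  have hα0 : α ≠ 0 := by rintro rfl; simp at hα
  have hterm : v (ramCoeff f α j * ((β - α) / α) ^ j) =
      ((ramBound b j + j * q : ℚ) : WithTop ℚ) := by
    rw [v.map_mul, v.map_pow_of_eq_s14 hq, hRj, WithTop.coe_add]
  refine AddValuation.sum_ne_zero_of_lt (v := v) hj ?_ (fun i hi hij => ?_)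
    (sum_ramCoeff_mul_pow hf.natDegree_eq hα0 h0 h1)
  · rw [hterm]; exact WithTop.coe_ne_top
  · rw [hterm]
    obtain ⟨hi1, hi9⟩ := Finset.mem_Icc.1 hi
    exact (WithTop.coe_lt_coe.2 (hcon i hi1 hi9 hij)).trans_le
      (AddValuation.coe_le_mul (hf.ramBound_le hv hα hi) (v.map_pow_of_eq_s14 hq i).ge)

lemma HasDiscFifteen.exists_val_sub (hf : HasDiscFifteen b f) (hv : IsNinePadic v)
    (h0 : aeval α f = 0) (h1 : aeval β f = 0) (hne : α ≠ β) :
    ∃ q : ℚ, v (α - β) = ((q + 1 : ℚ) : WithTop ℚ) ∧ q ≤ 2 ∧ (q = 7 / 8 ↔ b = true) := by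
  have hα := hf.val_root hv h0
  have hα0 : α ≠ 0 := by rintro rfl; simp at hα
  obtain ⟨q, hq⟩ := v.exists_coe (div_ne_zero (sub_ne_zero.2 hne.symm) hα0)
  have hsub : v (α - β) = ((q + 1 : ℚ) : WithTop ℚ) := by
    rw [v.map_sub_swap, ← div_mul_cancel₀ (β - α) hα0, v.map_mul, hq, hα, WithTop.coe_add]; rfl
  have e1 := hf.exists_ramBound_le hv h0 h1 hq (j := 1) (by simp) (hf.val_ramCoeff_one hv hα)
  have e9 := hf.exists_ramBound_le hv h0 h1 hq (j := 9) (by simp) hf.val_ramCoeff_nine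
  refine ⟨q, hsub, ?_⟩
  cases b
  · have e3 := hf.exists_ramBound_le hv h0 h1 hq (j := 3) (by simp) (hf.val_ramCoeff_three hv hα)
    constructor
    · by_contra! hlt
      obtain ⟨i, hi1, hi9, hij, h⟩ := e1
      interval_cases i <;> norm_num [ramBound] at h hij <;> linarith
    · simp only [Bool.false_eq_true, iff_false]
      rintro rfl
      obtain ⟨i, hi1, hi9, hij, h⟩ := e3
      interval_cases i <;> first | exact absurd rfl hij | norm_num [ramBound] at h
  · have hle : q ≤ 7 / 8 := by
      by_contra! hlt
      obtain ⟨i, hi1, hi9, hij, h⟩ := e1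
      interval_cases i <;> norm_num [ramBound] at h hij <;> linarith
    have hge : 7 / 8 ≤ q := by
      by_contra! hlt
      obtain ⟨i, hi1, hi9, hij, h⟩ := e9
      interval_cases i <;> norm_num [ramBound] at h hij <;> linarith
    exact ⟨by linarith, by simp [le_antisymm hle hge]⟩

lemma HasDiscFifteen.eq_of_le_val_sub (hf : HasDiscFifteen b f) (hv : IsNinePadic v)
    (h0 : aeval α f = 0) (h1 : aeval β f = 0) (h : ((4 : ℚ) : WithTop ℚ) ≤ v (α - β)) :
    α = β := by
  by_contra hne
  obtain ⟨q, hq, h2, -⟩ := hf.exists_val_sub hv h0 h1 hne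
  rw [hq, WithTop.coe_le_coe] at h
  linarith

section

variable [IsAlgClosed E] [Algebra.IsAlgebraic ℚ_[3] E]

/-- The roots of a polynomial, as a finite set. -/
noncomputable def rootFinset (E : Type*) [Field E] [Algebra ℚ_[3] E] (f : ℚ_[3][X]) : Finset E :=
  letI := Classical.decEq E
  (f.aroots E).toFinset

omit [IsAlgClosed E] [Algebra.IsAlgebraic ℚ_[3] E] in
lemma IsEisensteinNine.mem_rootFinset (hf : IsEisensteinNine f) :
    α ∈ rootFinset E f ↔ aeval α f = 0 := by
  simp [rootFinset, hf.monic.ne_zero]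

lemma IsEisensteinNine.nodup_aroots (hf : IsEisensteinNine f) (hv : IsNinePadic v) :
    (f.aroots E).Nodup := by
  obtain ⟨β, hβ⟩ := IsAlgClosed.exists_aeval_eq_zero E f (by
    rw [degree_eq_natDegree hf.monic.ne_zero, hf.natDegree_eq]; norm_num)
  have hirr := minpoly.irreducible (Algebra.IsIntegral.isIntegral (R := ℚ_[3]) β)
  rw [hf.eq_minpoly hv hβ] at hirr
  exact nodup_roots hirr.separable.map

lemma IsEisensteinNine.rootFinset_val (hf : IsEisensteinNine f) (hv : IsNinePadic v) :
    (rootFinset E f).val = f.aroots E := by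
  classical
  rw [rootFinset, Multiset.toFinset_val]
  exact Multiset.dedup_eq_self.2 (hf.nodup_aroots hv)

lemma IsEisensteinNine.card_rootFinset (hf : IsEisensteinNine f) (hv : IsNinePadic v) :
    (rootFinset E f).card = 9 := by
  rw [← Finset.card_val, hf.rootFinset_val hv, IsAlgClosed.card_aroots_eq_natDegree]
  exact hf.natDegree_eq

lemma IsEisensteinNine.val_aeval (hf : IsEisensteinNine f) (hv : IsNinePadic v) (t : E) :
    v (aeval t f) = ∑ β ∈ rootFinset E f, v (t - β) := by
  rw [(IsAlgClosed.splits (f.map (algebraMap ℚ_[3] E))).aeval_eq_prod_aroots_of_monic hf.monic,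
    ← hf.rootFinset_val hv]
  exact v.map_prod' (rootFinset E f) (fun β => t - β)

open Classical in
lemma IsEisensteinNine.val_derivative (hf : IsEisensteinNine f) (hv : IsNinePadic v)
    (hα : aeval α f = 0) :
    v (aeval α (derivative f)) = ∑ β ∈ (rootFinset E f).erase α, v (α - β) := by
  have hmem : α ∈ (f.map (algebraMap ℚ_[3] E)).roots := by
    have := hf.mem_rootFinset.2 hα
    rwa [← Finset.mem_val, hf.rootFinset_val hv] at this
  have := (IsAlgClosed.splits (f.map (algebraMap ℚ_[3] E))).eval_root_derivative
    (hf.monic.map _) hmem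
  rw [derivative_map, eval_map_algebraMap] at this
  rw [this, ← v.map_prod']
  congr 1
  rw [Finset.prod, Finset.erase_val, hf.rootFinset_val hv]

/-- Near a root of `g`, the values of `g` are small. -/
lemma HasDiscFifteen.le_val_aeval (hg : HasDiscFifteen b g) (hv : IsNinePadic v)
    (h0 : aeval β g = 0) (h : ((4 : ℚ) : WithTop ℚ) ≤ v (α - β)) :
    ((19 : ℚ) : WithTop ℚ) ≤ v (aeval α g) := by
  classical
  rw [hg.val_aeval hv, ← Finset.add_sum_erase _ _ (hg.mem_rootFinset.2 h0),
    show (19 : ℚ) = 4 + 15 by norm_num, WithTop.coe_add, ← hg.val_derivative hv (hg.val_root hv h0),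
    hg.toIsEisensteinNine.val_derivative hv h0]
  refine add_le_add h (Finset.sum_le_sum fun γ hγ => ?_)
  have h1 : aeval γ g = 0 := hg.mem_rootFinset.1 (Finset.mem_of_mem_erase hγ)
  obtain ⟨q, hq, h2, -⟩ := hg.exists_val_sub hv h0 h1 (Finset.ne_of_mem_erase hγ).symm
  rw [show α - γ = (α - β) + (β - γ) by ring]
  refine le_trans (le_min ?_ le_rfl) (v.map_add _ _)
  rw [hq]
  exact (WithTop.coe_le_coe.2 (by linarith)).trans h

/-- If `g` takes a small value at `α`, then `α` is near a root of `g`. -/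
lemma HasDiscFifteen.exists_root_near (hg : HasDiscFifteen b g) (hv : IsNinePadic v)
    (h : ((19 : ℚ) : WithTop ℚ) ≤ v (aeval α g)) :
    ∃ β : E, aeval β g = 0 ∧ ((4 : ℚ) : WithTop ℚ) ≤ v (α - β) := by
  classical
  have hne : (rootFinset E g).Nonempty := by
    rw [← Finset.card_pos, hg.card_rootFinset hv]; norm_num
  obtain ⟨β, hβ, hmax⟩ := Finset.exists_max_image (rootFinset E g) (fun β => v (α - β)) hne
  have h0 := hg.mem_rootFinset.1 hβ
  refine ⟨β, h0, ?_⟩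
  rw [hg.val_aeval hv, ← Finset.add_sum_erase _ _ hβ] at h
  have h15 := hg.val_derivative hv (hg.val_root hv h0)
  rw [hg.toIsEisensteinNine.val_derivative hv h0] at h15
  have hle : ∑ γ ∈ (rootFinset E g).erase β, v (α - γ) ≤ ((15 : ℚ) : WithTop ℚ) := by
    rw [← h15]
    refine Finset.sum_le_sum fun γ hγ => ?_
    rw [show β - γ = (α - γ) - (α - β) by ring]
    exact v.map_le_sub le_rfl (hmax γ (Finset.mem_of_mem_erase hγ))
  have h2 := h.trans (add_le_add_right hle _)
  rw [show (19 : ℚ) = 4 + 15 by norm_num, WithTop.coe_add] at h2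
  exact (WithTop.add_le_add_iff_right WithTop.coe_ne_top).1 h2

end

end Roots

section Krasner

variable {E : Type*} [Field E] {v : AddValuation E (WithTop ℚ)}

/-- The order-reversing map `q ↦ 3 ^ (-q / 9)` sending `⊤` to `0`. -/
noncomputable def threePowNeg : WithTop ℚ → ℝ :=
  WithTop.recTopCoe 0 fun q => (3 : ℝ) ^ (-(q : ℝ) / 9)

@[simp] lemma threePowNeg_top : threePowNeg ⊤ = 0 := rfl

@[simp] lemma threePowNeg_coe (q : ℚ) : threePowNeg q = (3 : ℝ) ^ (-(q : ℝ) / 9) := rfl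

lemma threePowNeg_strictAnti : StrictAnti threePowNeg := by
  intro x y h
  obtain ⟨r, rfl⟩ := WithTop.ne_top_iff_exists.1 (ne_top_of_lt h)
  induction y with
  | top => rw [threePowNeg_top, threePowNeg_coe]; positivity
  | coe s =>
    rw [threePowNeg_coe, threePowNeg_coe]
    have hrs : (r : ℝ) < s := by exact_mod_cast WithTop.coe_lt_coe.1 h
    exact Real.rpow_lt_rpow_of_exponent_lt (by norm_num) (by linarith)

lemma threePowNeg_nonneg (x : WithTop ℚ) : 0 ≤ threePowNeg x :=
  threePowNeg_top ▸ threePowNeg_strictAnti.antitone le_top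

lemma threePowNeg_add (x y : WithTop ℚ) : threePowNeg (x + y) = threePowNeg x * threePowNeg y := by
  induction x with
  | top => simp
  | coe r =>
    induction y with
    | top => simp
    | coe s =>
      rw [← WithTop.coe_add, threePowNeg_coe, threePowNeg_coe, threePowNeg_coe,
        ← Real.rpow_add (by norm_num)]
      congr 1
      push_cast; ring

/-- The absolute value attached to an additive valuation. -/
noncomputable def AddValuation.toAbsoluteValue (v : AddValuation E (WithTop ℚ)) :
    AbsoluteValue E ℝ where
  toFun x := threePowNeg (v x)
  map_mul' x y := by rw [v.map_mul, threePowNeg_add]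
  nonneg' x := threePowNeg_nonneg _
  eq_zero' x := by
    rw [← threePowNeg_top, threePowNeg_strictAnti.injective.eq_iff, v.top_iff]
  add_le' x y := by
    have h1 := threePowNeg_nonneg (v x)
    have h2 := threePowNeg_nonneg (v y)
    refine (threePowNeg_strictAnti.antitone (v.map_add x y)).trans ?_
    rw [threePowNeg_strictAnti.antitone.map_min]
    exact max_le (by linarith) (by linarith)

variable [Algebra ℚ_[3] E]

lemma IsNinePadic.toAbsoluteValue_algebraMap (hv : IsNinePadic v) (x : ℚ_[3]) :
    v.toAbsoluteValue (algebraMap ℚ_[3] E x) = ‖x‖ := by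
  rcases eq_or_ne x 0 with rfl | hx
  · simp
  · change threePowNeg _ = _
    rw [hv x hx, threePowNeg_coe, Padic.norm_eq_zpow_neg_valuation hx, ← Real.rpow_intCast]
    push_cast
    congr 1
    ring

lemma IsNinePadic.mem_adjoin_of_lt [Algebra.IsAlgebraic ℚ_[3] E] [IsAlgClosed E]
    (hv : IsNinePadic v) {x y : E}
    (h : ∀ x', IsConjRoot ℚ_[3] x x' → x ≠ x' → v (x - x') < v (x - y)) :
    x ∈ IntermediateField.adjoin ℚ_[3] {y} := by
  let : NormedField E := v.toAbsoluteValue.toNormedField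
  let : NormedAlgebra ℚ_[3] E :=
    { (inferInstance : Algebra ℚ_[3] E) with
      norm_smul_le := fun r x => by
        rw [Algebra.smul_def]
        change v.toAbsoluteValue _ ≤ _ * v.toAbsoluteValue x
        rw [map_mul, hv.toAbsoluteValue_algebraMap] }
  refine IsKrasner.krasner (K := ℚ_[3]) ?_ (IsAlgClosed.splits _)
    (Algebra.IsIntegral.isIntegral y) fun x' hx' hne => ?_
  · exact (minpoly.irreducible (Algebra.IsIntegral.isIntegral x)).separable
  · exact threePowNeg_strictAnti (h x' hx' hne)

end Krasner

section Transfer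

variable {E : Type*} [Field E] [Algebra ℚ_[3] E] {v : AddValuation E (WithTop ℚ)}
  {f g : ℚ_[3][X]} {b : Bool} {α β : E}

/-- The triples of coefficients modulo `3` of `d₁ X + d₂ X ^ 2 + d₃ X ^ 3` with `d₁` a unit. -/
def digitTriples : Finset (ℤ × ℤ × ℤ) := {-1, 1} ×ˢ {-1, 0, 1} ×ˢ {-1, 0, 1}

/-- The polynomial `d₁ X + d₂ X ^ 2 + d₃ X ^ 3`. -/
noncomputable def digitPoly (d : ℤ × ℤ × ℤ) : ℚ_[3][X] :=
  C (d.1 : ℚ_[3]) * X + C (d.2.1 : ℚ_[3]) * X ^ 2 + C (d.2.2 : ℚ_[3]) * X ^ 3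

lemma aeval_digitPoly (d : ℤ × ℤ × ℤ) (t : E) :
    aeval t (digitPoly d) = d.1 * t + d.2.1 * t ^ 2 + d.2.2 * t ^ 3 := by
  simp [digitPoly]

lemma IsNinePadic.le_intCast (hv : IsNinePadic v) (k : ℤ) :
    ((0 : ℚ) : WithTop ℚ) ≤ v (k : E) := by
  have := hv.le_of_dvd (n := 0) (c := (k : ℚ_[3])) (ThreePowDvd.intCast_iff.2 (by simp))
  rw [map_intCast] at this
  simpa using this

omit [Algebra ℚ_[3] E] in
lemma val_fst_of_mem_digitTriples {d : ℤ × ℤ × ℤ} (hd : d ∈ digitTriples) :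
    v (d.1 : E) = ((0 : ℚ) : WithTop ℚ) := by
  simp only [digitTriples, Finset.mem_product, Finset.mem_insert, Finset.mem_singleton] at hd
  rcases hd.1 with h | h <;> rw [h] <;> simp

lemma IsNinePadic.val_digitPoly_sub (hv : IsNinePadic v) {d : ℤ × ℤ × ℤ}
    (hd : d ∈ digitTriples) (hα : v α = 1) (hβ : ((1 : ℚ) : WithTop ℚ) ≤ v β) :
    v (aeval α (digitPoly d) - aeval β (digitPoly d)) = v (α - β) := by
  have hα' : ((1 : ℚ) : WithTop ℚ) ≤ v α := hα.ge
  have h1 : ((1 : ℚ) : WithTop ℚ) ≤ v ((d.2.1 : E) * (α + β)) := by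
    have := AddValuation.coe_le_mul (hv.le_intCast d.2.1) (v.map_le_add hα' hβ)
    simpa using this
  have h2 : ((1 : ℚ) : WithTop ℚ) ≤ v ((d.2.2 : E) * (α ^ 2 + α * β + β ^ 2)) := by
    have e : ∀ x y : E, ((1 : ℚ) : WithTop ℚ) ≤ v x → ((1 : ℚ) : WithTop ℚ) ≤ v y →
        ((1 : ℚ) : WithTop ℚ) ≤ v (x * y) := fun x y hx hy =>
      (WithTop.coe_le_coe.2 (by norm_num)).trans (AddValuation.coe_le_mul hx hy)
    have := AddValuation.coe_le_mul (hv.le_intCast d.2.2) (v.map_le_add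
      (v.map_le_add (e α α hα' hα') (e α β hα' hβ)) (e β β hβ hβ))
    rw [← pow_two, ← pow_two] at this
    simpa using this
  have h0 : v ((d.1 : E) + ((d.2.1 : E) * (α + β) + (d.2.2 : E) * (α ^ 2 + α * β + β ^ 2))) =
      ((0 : ℚ) : WithTop ℚ) := by
    rw [← val_fst_of_mem_digitTriples (v := v) hd]
    refine v.map_add_eq_of_lt_left ?_
    rw [val_fst_of_mem_digitTriples hd]
    exact (WithTop.coe_lt_coe.2 (by norm_num)).trans_le (v.map_le_add h1 h2)
  have : aeval α (digitPoly d) - aeval β (digitPoly d) = (α - β) *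
      ((d.1 : E) + ((d.2.1 : E) * (α + β) + (d.2.2 : E) * (α ^ 2 + α * β + β ^ 2))) := by
    rw [aeval_digitPoly, aeval_digitPoly]; ring
  rw [this, v.map_mul, h0, WithTop.coe_zero, add_zero]

lemma IsNinePadic.val_digitPoly (hv : IsNinePadic v) {d : ℤ × ℤ × ℤ}
    (hd : d ∈ digitTriples) (hα : v α = 1) : v (aeval α (digitPoly d)) = 1 := by
  have := hv.val_digitPoly_sub hd hα (β := 0) (by simp)
  simpa [aeval_digitPoly, hα] using this

variable [IsAlgClosed E] [Algebra.IsAlgebraic ℚ_[3] E]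

lemma HasDiscFifteen.mem_adjoin (hf : HasDiscFifteen b f) (hv : IsNinePadic v)
    (hα : aeval α f = 0) (h : ((4 : ℚ) : WithTop ℚ) ≤ v (α - β)) :
    α ∈ IntermediateField.adjoin ℚ_[3] {β} := by
  refine hv.mem_adjoin_of_lt fun α' hα' hne => ?_
  have h1 : aeval α' f = 0 := by
    rw [← hf.eq_minpoly hv hα]; exact hα'.aeval_eq_zero
  obtain ⟨q, hq, h2, -⟩ := hf.exists_val_sub hv hα h1 hne
  rw [hq]
  exact (WithTop.coe_lt_coe.2 (by linarith)).trans_le h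

omit [IsAlgClosed E] in
lemma IsEisensteinNine.finrank_adjoin (hf : IsEisensteinNine f) (hv : IsNinePadic v)
    (hα : aeval α f = 0) :
    Module.finrank ℚ_[3] (IntermediateField.adjoin ℚ_[3] {α}) = 9 := by
  rw [IntermediateField.adjoin.finrank (Algebra.IsIntegral.isIntegral α), hf.eq_minpoly hv hα,
    hf.natDegree_eq]

omit [IsAlgClosed E] in
/-- Elements of valuation one of an extension of degree nine generate it. -/
lemma IsEisensteinNine.natDegree_minpoly (hf : IsEisensteinNine f) (hv : IsNinePadic v)
    (hα : aeval α f = 0) {t : E} (ht : v t = 1)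
    (hmem : t ∈ IntermediateField.adjoin ℚ_[3] {α}) : (minpoly ℚ_[3] t).natDegree = 9 := by
  refine le_antisymm ?_ (hv.nine_le_natDegree_minpoly ht)
  have : FiniteDimensional ℚ_[3] (IntermediateField.adjoin ℚ_[3] {α}) :=
    IntermediateField.adjoin.finiteDimensional (Algebra.IsIntegral.isIntegral α)
  have h := minpoly.natDegree_le (A := ℚ_[3])
    (⟨t, hmem⟩ : IntermediateField.adjoin ℚ_[3] {α})
  rw [hf.finrank_adjoin hv hα] at h
  rwa [IntermediateField.minpoly_eq] at h

omit [IsAlgClosed E] in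
lemma IsEisensteinNine.adjoin_eq_adjoin (hf : IsEisensteinNine f) (hv : IsNinePadic v)
    (hα : aeval α f = 0) {t : E} (ht : v t = 1)
    (hmem : t ∈ IntermediateField.adjoin ℚ_[3] {α}) :
    IntermediateField.adjoin ℚ_[3] {t} = IntermediateField.adjoin ℚ_[3] {α} := by
  have : FiniteDimensional ℚ_[3] (IntermediateField.adjoin ℚ_[3] {α}) :=
    IntermediateField.adjoin.finiteDimensional (Algebra.IsIntegral.isIntegral α)
  refine IntermediateField.eq_of_le_of_finrank_eq
    (IntermediateField.adjoin_simple_le_iff.2 hmem) ?_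
  rw [hf.finrank_adjoin hv hα,
    IntermediateField.adjoin.finrank (Algebra.IsIntegral.isIntegral t),
    hf.natDegree_minpoly hv hα ht hmem]

omit [IsAlgClosed E] [Algebra.IsAlgebraic ℚ_[3] E] in
lemma aeval_mem_adjoin (p : ℚ_[3][X]) (α : E) :
    aeval α p ∈ IntermediateField.adjoin ℚ_[3] {α} :=
  IntermediateField.algebra_adjoin_le_adjoin _ _ (aeval_mem_adjoin_singleton ℚ_[3] α)

/-- Being of discriminant valuation `15`, and the shape of the ramification polygon, do not change
when passing from `α` to another uniformizer `d₁ α + d₂ α ^ 2 + d₃ α ^ 3`. -/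
lemma HasDiscFifteen.minpoly_digitPoly (hf : HasDiscFifteen b f) (hv : IsNinePadic v)
    (hα : aeval α f = 0) {d : ℤ × ℤ × ℤ} (hd : d ∈ digitTriples) :
    HasDiscFifteen b (minpoly ℚ_[3] (aeval α (digitPoly d))) := by
  classical
  set t := aeval α (digitPoly d) with ht_def
  have hα1 := hf.val_root hv hα
  have ht : v t = 1 := hv.val_digitPoly hd hα1
  have hg := hv.isEisensteinNine_minpoly ht
    (hf.natDegree_minpoly hv hα ht (aeval_mem_adjoin _ _))
  have ht0 := minpoly.aeval ℚ_[3] t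
  set g := minpoly ℚ_[3] t
  have hmaps : ∀ γ ∈ rootFinset E f, aeval γ (digitPoly d) ∈ rootFinset E g := by
    intro γ hγ
    have hγ0 := hf.mem_rootFinset.1 hγ
    rw [hg.mem_rootFinset, ← aeval_comp]
    refine aeval_eq_zero_of_dvd_aeval_eq_zero (p := f) ?_ hγ0
    rw [← hf.eq_minpoly hv hα]
    exact minpoly.dvd _ _ (by rw [aeval_comp]; exact ht0)
  have hval : ∀ γ ∈ rootFinset E f, ∀ δ ∈ rootFinset E f,
      v (aeval γ (digitPoly d) - aeval δ (digitPoly d)) = v (γ - δ) := fun γ hγ δ hδ =>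
    hv.val_digitPoly_sub hd (hf.val_root hv (hf.mem_rootFinset.1 hγ))
      (hf.val_root hv (hf.mem_rootFinset.1 hδ)).ge
  have hinj : Set.InjOn (fun γ : E => aeval γ (digitPoly d)) (rootFinset E f) := by
    intro γ hγ δ hδ h
    have := hval γ hγ δ hδ
    rw [sub_eq_zero.2 h, v.map_zero] at this
    exact sub_eq_zero.1 (v.top_iff.1 this.symm)
  have himage : (rootFinset E f).image (fun γ => aeval γ (digitPoly d)) = rootFinset E g := by
    refine Finset.eq_of_subset_of_card_le (Finset.image_subset_iff.2 hmaps) ?_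
    rw [Finset.card_image_of_injOn hinj, hf.card_rootFinset hv, hg.card_rootFinset hv]
  have hαmem := hf.mem_rootFinset.2 hα
  have h15 : v (aeval t (derivative g)) = ((15 : ℚ) : WithTop ℚ) := by
    rw [hg.val_derivative hv ht0, ← hf.val_derivative hv hα1,
      hf.toIsEisensteinNine.val_derivative hv hα]
    symm
    refine Finset.sum_nbij (fun γ : E => aeval γ (digitPoly d)) (fun γ hγ => ?_)
      (hinj.mono (by simp)) (fun γ hγ => ?_) (fun γ hγ => ?_)
    · obtain ⟨hne, hmem⟩ := Finset.mem_erase.1 hγ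
      exact Finset.mem_erase.2 ⟨fun h => hne (hinj hmem hαmem h), hmaps γ hmem⟩
    · obtain ⟨hne, hmem⟩ := Finset.mem_erase.1 (Finset.mem_coe.1 hγ)
      rw [← himage] at hmem
      obtain ⟨δ, hδ, rfl⟩ := Finset.mem_image.1 hmem
      exact ⟨δ, Finset.mem_coe.2 (Finset.mem_erase.2 ⟨fun h => hne (by rw [h]), hδ⟩), rfl⟩
    · exact (hval α hαmem γ (Finset.mem_of_mem_erase hγ)).symm
  have hg15 := hg.hasDiscFifteen hv ht h15
  obtain ⟨γ, hγ, hne⟩ := Finset.exists_mem_ne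
    (by rw [hf.card_rootFinset hv]; norm_num : 1 < (rootFinset E f).card) α
  obtain ⟨q, hq, -, hqb⟩ := hf.exists_val_sub hv hα (hf.mem_rootFinset.1 hγ) hne.symm
  obtain ⟨q', hq', -, hqc⟩ := hg15.exists_val_sub hv ht0 (hg.mem_rootFinset.1 (hmaps γ hγ))
    fun h => hne (hinj hγ hαmem h.symm)
  rw [hval α hαmem γ hγ, hq, WithTop.coe_inj] at hq'
  rw [← add_right_cancel hq', hqb] at hqc
  rwa [Bool.eq_iff_iff.2 hqc]

end Transfer

section Representatives

variable {E : Type*} [Field E] [Algebra ℚ_[3] E] {v : AddValuation E (WithTop ℚ)}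
  {f : ℚ_[3][X]} {b : Bool} {α β : E} {a a' : Fin 9 → ℤ}

/-- Representatives of the coefficients of the polynomials in `HasDiscFifteen b`, modulo `27` for
the constant coefficient and modulo `9` for the other ones. -/
def coeffReps (b : Bool) : Fin 9 → Finset ℤ :=
  ![{3, -3, 12, -6, 6, -12}, {0}, {0}, if b then {0} else {3, -3}, {0}, {0}, {-3, 0, 3}, {3, -3},
    {-3, 0, 3}]

/-- The coefficient tuples of a set of representatives of the polynomials in `HasDiscFifteen b`. -/
def polyReps (b : Bool) : Finset (Fin 9 → ℤ) := Fintype.piFinset (coeffReps b)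

/-- The monic polynomial of degree nine with lower coefficients `a`. -/
noncomputable def monicNine (a : Fin 9 → ℤ) : ℚ_[3][X] :=
  X ^ 9 + ∑ i : Fin 9, C (a i : ℚ_[3]) * X ^ (i : ℕ)

lemma card_polyReps_true : (polyReps true).card = 108 := by
  rw [polyReps, Fintype.card_piFinset]; decide

lemma card_polyReps_false : (polyReps false).card = 216 := by
  rw [polyReps, Fintype.card_piFinset]; decide

lemma monic_monicNine (a : Fin 9 → ℤ) : (monicNine a).Monic :=
  monic_X_pow_add (degree_sum_fin_lt _)

lemma natDegree_monicNine (a : Fin 9 → ℤ) : (monicNine a).natDegree = 9 := by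
  refine natDegree_eq_of_degree_eq_some ?_
  rw [monicNine, degree_add_eq_left_of_degree_lt, degree_X_pow, Nat.cast_ofNat]
  rw [degree_X_pow]
  exact degree_sum_fin_lt _

lemma coeff_monicNine (a : Fin 9 → ℤ) (i : Fin 9) : (monicNine a).coeff i = a i := by
  rw [monicNine, coeff_add, coeff_X_pow, if_neg i.2.ne, zero_add, finsetSum_coeff,
    Finset.sum_eq_single i]
  · simp
  · intro j _ hj
    rw [coeff_C_mul_X_pow, if_neg fun h => hj (Fin.ext h.symm)]
  · simp

lemma threePowDvd_coeff_monicNine {n : ℕ} (i : Fin 9) :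
    ThreePowDvd n ((monicNine a).coeff i) ↔ (3 : ℤ) ^ n ∣ a i := by
  rw [coeff_monicNine, ThreePowDvd.intCast_iff]

lemma hasDiscFifteen_monicNine (ha : a ∈ polyReps b) : HasDiscFifteen b (monicNine a) := by
  have hmem : ∀ i, a i ∈ coeffReps b i := Fintype.mem_piFinset.1 ha
  refine ⟨⟨monic_monicNine a, natDegree_monicNine a, fun i hi => ?_, ?_⟩, ?_, ?_, ?_, ?_, ?_, ?_⟩
  · refine (threePowDvd_coeff_monicNine ⟨i, hi⟩).2 ?_
    have : ∀ (b : Bool) (i : Fin 9), ∀ x ∈ coeffReps b i, (3 : ℤ) ^ 1 ∣ x := by decide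
    exact this b _ _ (hmem _)
  · refine (threePowDvd_coeff_monicNine 0).not.2 ?_
    have : ∀ (b : Bool), ∀ x ∈ coeffReps b 0, ¬ (3 : ℤ) ^ 2 ∣ x := by decide
    exact this b _ (hmem _)
  · refine (threePowDvd_coeff_monicNine 7).not.2 ?_
    have : ∀ (b : Bool), ∀ x ∈ coeffReps b 7, ¬ (3 : ℤ) ^ 2 ∣ x := by decide
    exact this b _ (hmem _)
  · refine (threePowDvd_coeff_monicNine 1).2 ?_
    have : ∀ (b : Bool), ∀ x ∈ coeffReps b 1, (3 : ℤ) ^ 2 ∣ x := by decide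
    exact this b _ (hmem _)
  · refine (threePowDvd_coeff_monicNine 2).2 ?_
    have : ∀ (b : Bool), ∀ x ∈ coeffReps b 2, (3 : ℤ) ^ 2 ∣ x := by decide
    exact this b _ (hmem _)
  · refine (threePowDvd_coeff_monicNine 4).2 ?_
    have : ∀ (b : Bool), ∀ x ∈ coeffReps b 4, (3 : ℤ) ^ 2 ∣ x := by decide
    exact this b _ (hmem _)
  · refine (threePowDvd_coeff_monicNine 5).2 ?_
    have : ∀ (b : Bool), ∀ x ∈ coeffReps b 5, (3 : ℤ) ^ 2 ∣ x := by decide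
    exact this b _ (hmem _)
  · refine (threePowDvd_coeff_monicNine 3).trans ?_
    have : ∀ (b : Bool), ∀ x ∈ coeffReps b 3, (3 : ℤ) ^ 2 ∣ x ↔ b = true := by decide
    exact this b _ (hmem _)

lemma ThreePowDvd.exists_mod_nine {c : ℚ_[3]} (hc : ThreePowDvd 1 c) :
    ∃ k ∈ ({-3, 0, 3} : Finset ℤ), ThreePowDvd 2 (c - k) := by
  obtain ⟨k, hk, h⟩ := hc.exists_digit
  refine ⟨k * 3 ^ 1, ?_, h⟩
  have : ∀ k ∈ ({-1, 0, 1} : Finset ℤ), k * 3 ^ 1 ∈ ({-3, 0, 3} : Finset ℤ) := by decide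
  exact this k hk

lemma ThreePowDvd.exists_mod_nine_ne_zero {c : ℚ_[3]} (hc : ThreePowDvd 1 c)
    (hc2 : ¬ ThreePowDvd 2 c) : ∃ k ∈ ({3, -3} : Finset ℤ), ThreePowDvd 2 (c - k) := by
  obtain ⟨k, hk, h⟩ := hc.exists_mod_nine
  refine ⟨k, ?_, h⟩
  have hk0 : k ≠ 0 := by rintro rfl; simp [hc2] at h
  simp only [Finset.mem_insert, Finset.mem_singleton] at hk ⊢
  tauto

lemma ThreePowDvd.exists_mod_twentySeven {c : ℚ_[3]} (hc : ThreePowDvd 1 c)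
    (hc2 : ¬ ThreePowDvd 2 c) :
    ∃ k ∈ ({3, -3, 12, -6, 6, -12} : Finset ℤ), ThreePowDvd 3 (c - k) := by
  obtain ⟨k, hk, h⟩ := hc.exists_mod_nine_ne_zero hc2
  obtain ⟨l, hl, h'⟩ := h.exists_digit
  refine ⟨k + l * 3 ^ 2, ?_, ?_⟩
  · have : ∀ k ∈ ({3, -3} : Finset ℤ), ∀ l ∈ ({-1, 0, 1} : Finset ℤ),
      k + l * 3 ^ 2 ∈ ({3, -3, 12, -6, 6, -12} : Finset ℤ) := by decide
    exact this k hk l hl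
  · rw [Int.cast_add, ← sub_sub]; exact h'

/-- Every polynomial in `HasDiscFifteen b` is congruent to one of the representatives. -/
lemma HasDiscFifteen.exists_mem_polyReps (hf : HasDiscFifteen b f) :
    ∃ a ∈ polyReps b, ∀ i : Fin 9,
      ThreePowDvd (if i = 0 then 3 else 2) (f.coeff i - a i) := by
  have key : ∀ i : Fin 9, ∃ k ∈ coeffReps b i,
      ThreePowDvd (if i = 0 then 3 else 2) (f.coeff i - k) := by
    have hz : ∀ c : ℚ_[3], ThreePowDvd 2 c →
        ∃ k ∈ ({0} : Finset ℤ), ThreePowDvd 2 (c - k) := fun c hc => ⟨0, by simp, by simpa using hc⟩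
    have h1 := hf.dvd_coeff
    intro i
    fin_cases i
    · exact (h1 0 (by norm_num)).exists_mod_twentySeven hf.coeff_zero
    · exact hz _ hf.coeff_one
    · exact hz _ hf.coeff_two
    · cases b
      · exact (h1 3 (by norm_num)).exists_mod_nine_ne_zero (by simp [hf.coeff_three])
      · exact hz _ (hf.coeff_three.2 rfl)
    · exact hz _ hf.coeff_four
    · exact hz _ hf.coeff_five
    · exact (h1 6 (by norm_num)).exists_mod_nine
    · exact (h1 7 (by norm_num)).exists_mod_nine_ne_zero hf.coeff_seven
    · exact (h1 8 (by norm_num)).exists_mod_nine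
  choose a ha h using key
  exact ⟨a, Fintype.mem_piFinset.2 ha, h⟩

lemma HasDiscFifteen.exists_monicNine_near (hf : HasDiscFifteen b f) (hv : IsNinePadic v)
    (hα : aeval α f = 0) :
    ∃ a ∈ polyReps b, ((19 : ℚ) : WithTop ℚ) ≤ v (aeval α (monicNine a)) := by
  obtain ⟨a, ha, h⟩ := hf.exists_mem_polyReps
  refine ⟨a, ha, ?_⟩
  have hsub : aeval α (f - monicNine a) = - aeval α (monicNine a) := by
    rw [map_sub, hα, zero_sub]
  rw [← v.map_neg, ← hsub]
  refine hv.le_aeval (hf.val_root hv hα)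
    (hf.natDegree_sub_lt (hasDiscFifteen_monicNine ha).toIsEisensteinNine) fun i hi => ?_
  have hi' := h ⟨i, hi⟩
  rw [← coeff_monicNine a ⟨i, hi⟩, ← coeff_sub] at hi'
  refine ⟨_, hi', ?_⟩
  split_ifs with h0
  · push_cast; linarith [(Nat.cast_nonneg i : (0 : ℚ) ≤ i)]
  · have hi1 : (1 : ℚ) ≤ i := by
      exact_mod_cast Nat.one_le_iff_ne_zero.2 fun hi0 => h0 (Fin.ext hi0)
    push_cast; linarith

lemma eq_of_monicNine_near (hv : IsNinePadic v) (ha : a ∈ polyReps b) (ha' : a' ∈ polyReps b)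
    (h0 : aeval α (monicNine a') = 0)
    (h : ((19 : ℚ) : WithTop ℚ) ≤ v (aeval α (monicNine a))) : a = a' := by
  have hf := hasDiscFifteen_monicNine ha
  have hf' := hasDiscFifteen_monicNine ha'
  have hsub : aeval α (monicNine a - monicNine a') = aeval α (monicNine a) := by
    rw [map_sub, h0, sub_zero]
  rw [← hsub] at h
  have hlt := (WithTop.coe_lt_coe.2 (by norm_num : (18 : ℚ) < 19)).trans_le h
  funext i
  have hdvd : ThreePowDvd (if i = 0 then 3 else 2) ((monicNine a - monicNine a').coeff i) := by
    refine hv.dvd_coeff_of_lt (hf'.val_root hv h0)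
      (hf.natDegree_sub_lt hf'.toIsEisensteinNine) hlt i.2 _ ?_
    split_ifs with hi
    · rw [hi]; norm_num
    · have : (i : ℚ) ≤ 8 := by exact_mod_cast Nat.le_of_lt_succ i.2
      push_cast; linarith
  rw [coeff_sub, coeff_monicNine, coeff_monicNine, ← Int.cast_sub, ThreePowDvd.intCast_iff] at hdvd
  have : ∀ (b : Bool) (i : Fin 9), ∀ x ∈ coeffReps b i, ∀ y ∈ coeffReps b i,
      (3 : ℤ) ^ (if i = 0 then 3 else 2) ∣ x - y → x = y := by decide
  exact this b i _ (Fintype.mem_piFinset.1 ha i) _ (Fintype.mem_piFinset.1 ha' i) hdvd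

variable [IsAlgClosed E] [Algebra.IsAlgebraic ℚ_[3] E]

/-- The roots of all the representatives. -/
noncomputable def repRoots (E : Type*) [Field E] [Algebra ℚ_[3] E] (b : Bool) : Finset E :=
  letI := Classical.decEq E
  (polyReps b).biUnion fun a => rootFinset E (monicNine a)

omit [IsAlgClosed E] [Algebra.IsAlgebraic ℚ_[3] E] in
lemma mem_repRoots : α ∈ repRoots E b ↔ ∃ a ∈ polyReps b, aeval α (monicNine a) = 0 := by
  classical
  rw [repRoots, Finset.mem_biUnion]
  exact exists_congr fun a => and_congr_right fun ha =>
    (hasDiscFifteen_monicNine ha).mem_rootFinset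

lemma card_repRoots (hv : IsNinePadic v) : (repRoots E b).card = 9 * (polyReps b).card := by
  classical
  rw [repRoots, Finset.card_biUnion, mul_comm]
  · exact Finset.sum_const_nat fun a ha => (hasDiscFifteen_monicNine ha).card_rootFinset hv
  · intro a ha a' ha' hne
    refine Finset.disjoint_left.2 fun α hα hα' => hne ?_
    rw [(hasDiscFifteen_monicNine ha).mem_rootFinset] at hα
    rw [(hasDiscFifteen_monicNine ha').mem_rootFinset] at hα'
    exact eq_of_monicNine_near hv ha ha' hα' (by rw [hα, v.map_zero]; exact le_top)

lemma eq_of_mem_repRoots (hv : IsNinePadic v) (hα : α ∈ repRoots E b) (hβ : β ∈ repRoots E b)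
    (h : ((4 : ℚ) : WithTop ℚ) ≤ v (α - β)) : α = β := by
  obtain ⟨a, ha, h0⟩ := mem_repRoots.1 hα
  obtain ⟨a', ha', h0'⟩ := mem_repRoots.1 hβ
  have := eq_of_monicNine_near hv ha' ha h0
    ((hasDiscFifteen_monicNine ha').le_val_aeval hv h0' h)
  subst this
  exact (hasDiscFifteen_monicNine ha).eq_of_le_val_sub hv h0 h0' h

lemma HasDiscFifteen.exists_mem_repRoots (hf : HasDiscFifteen b f) (hv : IsNinePadic v)
    (hα : aeval α f = 0) :
    ∃ β ∈ repRoots E b, ((4 : ℚ) : WithTop ℚ) ≤ v (α - β) ∧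
      IntermediateField.adjoin ℚ_[3] {β} = IntermediateField.adjoin ℚ_[3] {α} := by
  obtain ⟨a, ha, h⟩ := hf.exists_monicNine_near hv hα
  have hg := hasDiscFifteen_monicNine ha
  obtain ⟨β, hβ, hβ4⟩ := hg.exists_root_near hv h
  refine ⟨β, mem_repRoots.2 ⟨a, ha, hβ⟩, hβ4, ?_⟩
  exact (hg.adjoin_eq_adjoin hv hβ (hf.val_root hv hα) (hf.mem_adjoin hv hα hβ4)).symm

end Representatives

section Counting

variable {E : Type*} [Field E] [Algebra ℚ_[3] E] {v : AddValuation E (WithTop ℚ)}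
  {f : ℚ_[3][X]} {b : Bool} {α β : E} [Algebra.IsAlgebraic ℚ_[3] E]

lemma IsEisensteinNine.exists_aeval_eq (hf : IsEisensteinNine f) (hα : aeval α f = 0) {y : E}
    (hy : y ∈ IntermediateField.adjoin ℚ_[3] {α}) :
    ∃ p : ℚ_[3][X], p.natDegree < 9 ∧ aeval α p = y := by
  rw [← IntermediateField.mem_toSubalgebra, IntermediateField.adjoin_simple_toSubalgebra_of_isAlgebraic
    (Algebra.IsAlgebraic.isAlgebraic α), Algebra.adjoin_singleton_eq_range_aeval] at hy
  obtain ⟨p, rfl⟩ := hy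
  refine ⟨p %ₘ f, ?_, aeval_modByMonic_eq_self_of_root hα⟩
  rw [← hf.natDegree_eq]
  exact natDegree_modByMonic_lt p hf.monic fun h => by
    have := hf.natDegree_eq
    simp [h] at this

lemma IsEisensteinNine.exists_val_sub_pow (hf : IsEisensteinNine f) (hv : IsNinePadic v)
    (hα : aeval α f = 0) {y : E} (hy : y ∈ IntermediateField.adjoin ℚ_[3] {α}) {k : ℕ}
    (hk1 : 1 ≤ k) (hk8 : k ≤ 8) (hky : ((k : ℚ) : WithTop ℚ) ≤ v y) :
    ∃ d ∈ ({-1, 0, 1} : Finset ℤ), ((k + 1 : ℚ) : WithTop ℚ) ≤ v (y - d * α ^ k) := by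
  obtain ⟨p, hp, rfl⟩ := hf.exists_aeval_eq hα hy
  have hα1 := hf.val_root hv hα
  have hlt : ((k - 1 / 2 : ℚ) : WithTop ℚ) < v (aeval α p) :=
    (WithTop.coe_lt_coe.2 (by linarith)).trans_le hky
  have hk1' : (1 : ℚ) ≤ k := by exact_mod_cast hk1
  have hk8' : (k : ℚ) ≤ 8 := by exact_mod_cast hk8
  have hge : ∀ i < 9, ThreePowDvd 0 (p.coeff i) := fun i hi => by
    have hi' : (i : ℚ) ≤ 8 := by exact_mod_cast Nat.le_of_lt_succ hi
    exact hv.dvd_coeff_of_lt hα1 hp hlt hi 0 (by push_cast; linarith)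
  obtain ⟨d, hd, hd1⟩ := (hge k (by omega)).exists_digit
  refine ⟨d, hd, ?_⟩
  have hsub : aeval α p - d * α ^ k = aeval α (p - C (d : ℚ_[3]) * X ^ k) := by simp
  rw [hsub]
  have hdeg : (p - C (d : ℚ_[3]) * X ^ k).natDegree < 9 :=
    (natDegree_sub_le _ _).trans_lt
      (max_lt hp ((natDegree_C_mul_X_pow_le _ _).trans_lt (by omega)))
  refine hv.le_aeval hα1 hdeg fun i hi => ?_
  rw [coeff_sub, coeff_C_mul_X_pow]
  rcases lt_trichotomy i k with h | rfl | h
  · have h' : (i : ℚ) ≤ k - 1 := by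
      have : (i : ℚ) + 1 ≤ k := by exact_mod_cast h
      linarith
    refine ⟨1, ?_, ?_⟩
    · rw [if_neg h.ne, sub_zero]
      exact hv.dvd_coeff_of_lt hα1 hp hlt hi 1 (by push_cast; linarith)
    · have : (0 : ℚ) ≤ i := Nat.cast_nonneg i
      push_cast; linarith
  · exact ⟨1, by simpa using hd1, by push_cast; linarith⟩
  · have h' : (k : ℚ) + 1 ≤ i := by exact_mod_cast h
    refine ⟨0, ?_, by push_cast; linarith⟩
    rw [if_neg h.ne', sub_zero]
    exact hge i hi

lemma IsEisensteinNine.exists_digitPoly_near (hf : IsEisensteinNine f) (hv : IsNinePadic v)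
    (hα : aeval α f = 0) {y : E} (hy : y ∈ IntermediateField.adjoin ℚ_[3] {α}) (hy1 : v y = 1) :
    ∃ d ∈ digitTriples, ((4 : ℚ) : WithTop ℚ) ≤ v (y - aeval α (digitPoly d)) := by
  have hmem : ∀ (z : E) (d : ℤ) (k : ℕ), z ∈ IntermediateField.adjoin ℚ_[3] {α} →
      z - d * α ^ k ∈ IntermediateField.adjoin ℚ_[3] {α} := fun z d k hz =>
    sub_mem hz (mul_mem (intCast_mem _ d)
      (pow_mem (IntermediateField.mem_adjoin_simple_self ℚ_[3] α) k))
  obtain ⟨d₁, h₁, e₁⟩ := hf.exists_val_sub_pow hv hα hy (k := 1) le_rfl (by norm_num)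
    (by rw [hy1]; norm_num)
  obtain ⟨d₂, h₂, e₂⟩ := hf.exists_val_sub_pow hv hα (hmem _ d₁ 1 hy) (k := 2) (by norm_num)
    (by norm_num) (le_trans (WithTop.coe_le_coe.2 (by norm_num)) e₁)
  obtain ⟨d₃, h₃, e₃⟩ := hf.exists_val_sub_pow hv hα (hmem _ d₂ 2 (hmem _ d₁ 1 hy)) (k := 3)
    (by norm_num) (by norm_num) (le_trans (WithTop.coe_le_coe.2 (by norm_num)) e₂)
  have hd₁ : d₁ ≠ 0 := by
    rintro rfl
    rw [Int.cast_zero, zero_mul, sub_zero, hy1] at e₁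
    have := WithTop.coe_le_coe.1 (show (_ : WithTop ℚ) ≤ ((1 : ℚ) : WithTop ℚ) from e₁)
    norm_num at this
  refine ⟨(d₁, d₂, d₃), ?_, ?_⟩
  · simp only [digitTriples, Finset.mem_product]
    refine ⟨?_, h₂, h₃⟩
    simp only [Finset.mem_insert, Finset.mem_singleton] at h₁ ⊢
    tauto
  · rw [aeval_digitPoly, ← sub_sub, ← sub_sub]
    rw [pow_one] at e₃
    exact le_trans (WithTop.coe_le_coe.2 (by norm_num)) e₃

omit [Algebra.IsAlgebraic ℚ_[3] E] in
lemma IsNinePadic.eq_of_digitPoly_near (hv : IsNinePadic v) (hα : v α = 1) {d d' : ℤ × ℤ × ℤ}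
    (hd : d ∈ digitTriples) (hd' : d' ∈ digitTriples)
    (h : ((4 : ℚ) : WithTop ℚ) ≤ v (aeval α (digitPoly d) - aeval α (digitPoly d'))) : d = d' := by
  have hlt := (WithTop.coe_lt_coe.2 (by norm_num : (3 : ℚ) < 4)).trans_le h
  rw [← map_sub] at hlt
  have hdeg : (digitPoly d - digitPoly d').natDegree < 9 := by
    refine lt_of_le_of_lt (b := 3) ?_ (by norm_num)
    unfold digitPoly
    compute_degree
  have key : ∀ i : ℕ, i ≤ 3 → ThreePowDvd 1 ((digitPoly d - digitPoly d').coeff i) :=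
    fun i hi => hv.dvd_coeff_of_lt hα hdeg hlt (by omega) 1 (by
      have : (i : ℚ) ≤ 3 := by exact_mod_cast hi
      push_cast; linarith)
  have k1 := key 1 (by norm_num)
  have k2 := key 2 (by norm_num)
  have k3 := key 3 (by norm_num)
  simp only [digitPoly, coeff_sub, coeff_add, coeff_C_mul_X_pow, coeff_C_mul_X] at k1 k2 k3
  norm_num [← Int.cast_sub, ThreePowDvd.intCast_iff] at k1 k2 k3
  have hinj : ∀ d ∈ digitTriples, ∀ d' ∈ digitTriples, 3 ∣ d.1 - d'.1 → 3 ∣ d.2.1 - d'.2.1 →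
      3 ∣ d.2.2 - d'.2.2 → d = d' := by decide
  exact hinj d hd d' hd' k1 k2 k3

variable [IsAlgClosed E]

open Classical in
lemma HasDiscFifteen.card_filter_repRoots (hf : HasDiscFifteen b f) (hv : IsNinePadic v)
    (hα : aeval α f = 0) :
    {β ∈ repRoots E b | IntermediateField.adjoin ℚ_[3] {β} =
      IntermediateField.adjoin ℚ_[3] {α}}.card = 18 := by
  have hα1 := hf.val_root hv hα
  have key : ∀ d ∈ digitTriples, ∃ β ∈ repRoots E b,
      ((4 : ℚ) : WithTop ℚ) ≤ v (aeval α (digitPoly d) - β) ∧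
      IntermediateField.adjoin ℚ_[3] {β} = IntermediateField.adjoin ℚ_[3] {α} := by
    intro d hd
    obtain ⟨β, hβ, h4, hadj⟩ :=
      (hf.minpoly_digitPoly hv hα hd).exists_mem_repRoots hv (minpoly.aeval _ _)
    refine ⟨β, hβ, h4, hadj.trans ?_⟩
    exact hf.adjoin_eq_adjoin hv hα (hv.val_digitPoly hd hα1) (aeval_mem_adjoin _ _)
  choose φ hφ h4 hadj using key
  have hcard : digitTriples.card = 18 := by decide
  rw [← hcard]
  symm
  refine Finset.card_bij φ (fun d hd => Finset.mem_filter.2 ⟨hφ d hd, hadj d hd⟩)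
    (fun d hd d' hd' heq => ?_) (fun β hβ => ?_)
  · refine hv.eq_of_digitPoly_near hα1 hd hd' ?_
    have h := h4 d' hd'
    rw [← heq] at h
    rw [← sub_sub_sub_cancel_right _ _ (φ d hd)]
    exact v.map_le_sub (h4 d hd) h
  · obtain ⟨hβ, hβadj⟩ := Finset.mem_filter.1 hβ
    obtain ⟨a, ha, hβ0⟩ := mem_repRoots.1 hβ
    obtain ⟨d, hd, hd4⟩ := hf.exists_digitPoly_near hv hα (y := β)
      (hβadj ▸ IntermediateField.mem_adjoin_simple_self ℚ_[3] β)
      ((hasDiscFifteen_monicNine ha).val_root hv hβ0)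
    refine ⟨d, hd, (eq_of_mem_repRoots hv hβ (hφ d hd) ?_).symm⟩
    rw [← sub_add_sub_cancel]
    exact v.map_le_add hd4 (h4 d hd)

/-- The number of fields generated by a root of a polynomial in `HasDiscFifteen b`. -/
lemma two_mul_card_fields (hv : IsNinePadic v) (b : Bool) :
    2 * Nat.card {L : IntermediateField ℚ_[3] E // ∃ f : ℚ_[3][X], ∃ α : E,
      HasDiscFifteen b f ∧ aeval α f = 0 ∧ L = IntermediateField.adjoin ℚ_[3] {α}} =
    (polyReps b).card := by
  classical
  let F : E → IntermediateField ℚ_[3] E := fun α => IntermediateField.adjoin ℚ_[3] {α}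
  have hset : ∀ L : IntermediateField ℚ_[3] E, (∃ f : ℚ_[3][X], ∃ α : E,
      HasDiscFifteen b f ∧ aeval α f = 0 ∧ L = IntermediateField.adjoin ℚ_[3] {α}) ↔
      L ∈ (repRoots E b).image F := by
    intro L
    rw [Finset.mem_image]
    constructor
    · rintro ⟨f, α, hf, hα, rfl⟩
      obtain ⟨β, hβ, -, hadj⟩ := hf.exists_mem_repRoots hv hα
      exact ⟨β, hβ, hadj⟩
    · rintro ⟨α, hα, rfl⟩
      obtain ⟨a, ha, h0⟩ := mem_repRoots.1 hα
      exact ⟨monicNine a, α, hasDiscFifteen_monicNine ha, h0, rfl⟩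
  rw [Nat.card_congr (Equiv.subtypeEquivRight hset), Nat.card_eq_fintype_card, Fintype.card_coe]
  have h1 := Finset.card_eq_sum_card_image F (repRoots E b)
  rw [card_repRoots hv, Finset.sum_const_nat (m := 18)] at h1
  · omega
  · intro L hL
    obtain ⟨f, α, hf, hα, rfl⟩ := (hset L).2 hL
    exact hf.card_filter_repRoots hv hα

end Counting

section PadicSetup

lemma strictMono_nine_mul : StrictMono fun x : WithTop ℚ => ((9 : ℚ) : WithTop ℚ) * x := by
  intro x y h
  obtain ⟨r, rfl⟩ := WithTop.ne_top_iff_exists.1 (ne_top_of_lt h)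
  induction y with
  | top =>
    simp only
    rw [WithTop.mul_top (WithTop.coe_ne_zero.2 (by norm_num)), ← WithTop.coe_mul]
    exact WithTop.coe_lt_top _
  | coe s =>
    simp only [← WithTop.coe_mul]
    have := WithTop.coe_lt_coe.1 h
    exact WithTop.coe_lt_coe.2 (by linarith)

lemma nine_mul_add (x y : WithTop ℚ) : ((9 : ℚ) : WithTop ℚ) * (x + y) =
    ((9 : ℚ) : WithTop ℚ) * x + ((9 : ℚ) : WithTop ℚ) * y := by
  have h9 : ((9 : ℚ) : WithTop ℚ) ≠ 0 := WithTop.coe_ne_zero.2 (by norm_num)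
  induction x with
  | top => rw [top_add, WithTop.mul_top h9, top_add]
  | coe r =>
    induction y with
    | top => rw [add_top, WithTop.mul_top h9, add_top]
    | coe s => simp only [← WithTop.coe_add, ← WithTop.coe_mul, mul_add]

namespace PadicSetup

lemma map_one (S : PadicSetup p K Ω) : S.v 1 = 0 := by
  have h := S.v_mul 1 1
  have hne : S.v 1 ≠ ⊤ := fun h => one_ne_zero ((S.v_top_iff 1).1 h)
  obtain ⟨q, hq⟩ := WithTop.ne_top_iff_exists.1 hne
  rw [mul_one, ← hq, ← WithTop.coe_add, WithTop.coe_inj] at h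
  rw [← hq, show q = 0 by linarith, WithTop.coe_zero]

/-- Nine times the valuation of a `PadicSetup`. -/
noncomputable def nineVal (S : PadicSetup p K Ω) : AddValuation Ω (WithTop ℚ) :=
  AddValuation.of (fun x => ((9 : ℚ) : WithTop ℚ) * S.v x)
    (by rw [(S.v_top_iff 0).2 rfl, WithTop.mul_top (WithTop.coe_ne_zero.2 (by norm_num))])
    (by rw [S.map_one, mul_zero])
    (fun x y => by
      rw [← strictMono_nine_mul.monotone.map_min]
      exact strictMono_nine_mul.monotone (S.v_add x y))
    (fun x y => by rw [S.v_mul, nine_mul_add])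

lemma nineVal_apply (S : PadicSetup p K Ω) (x : Ω) :
    S.nineVal x = ((9 : ℚ) : WithTop ℚ) * S.v x := rfl

variable {Ω : Type*} [Field Ω] [Algebra ℚ_[3] Ω] (S : PadicSetup 3 ℚ_[3] Ω)
  {f : ℚ_[3][X]} {b : Bool} {α : Ω}

lemma e_eq_one : S.e = 1 := by
  have h := S.v_unif
  have hne : S.unif ≠ 0 := by
    intro h0
    rw [h0, _root_.map_zero, (S.v_top_iff 0).2 rfl] at h
    exact WithTop.top_ne_one h
  rw [S.v_padic _ hne] at h
  have h1 : (((S.e : ℤ) * S.unif.valuation : ℤ) : ℚ) = 1 := WithTop.coe_eq_one.1 h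
  have h2 : (S.e : ℤ) * S.unif.valuation = 1 := by exact_mod_cast h1
  have h3 := Int.eq_one_or_neg_one_of_mul_eq_one h2
  omega

lemma isNinePadic_nineVal : IsNinePadic S.nineVal := by
  intro x hx
  rw [nineVal_apply, S.v_padic x hx, S.e_eq_one, ← WithTop.coe_mul]
  push_cast
  rw [one_mul]

lemma isEisensteinOfDegree_nine_iff : S.IsEisensteinOfDegree f 9 ↔ IsEisensteinNine f := by
  have hv := S.isNinePadic_nineVal
  have h1 : ∀ c : ℚ_[3], 1 ≤ S.v (algebraMap ℚ_[3] Ω c) ↔ ThreePowDvd 1 c := fun c => by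
    rw [← hv.coe_le_iff, nineVal_apply, ← strictMono_nine_mul.le_iff_le]
    simp
  have h2 : ∀ c : ℚ_[3], S.v (algebraMap ℚ_[3] Ω c) = 1 ↔
      S.nineVal (algebraMap ℚ_[3] Ω c) = ((9 : ℚ) : WithTop ℚ) := fun c => by
    rw [nineVal_apply, ← strictMono_nine_mul.injective.eq_iff]
    simp
  constructor
  · rintro ⟨hm, hd, hc, h0⟩
    refine ⟨hm, hd, fun i hi => (h1 _).1 (hc i hi), fun h => ?_⟩
    have h18 := hv.le_of_dvd h
    rw [(h2 _).1 h0, WithTop.coe_le_coe] at h18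
    norm_num at h18
  · rintro ⟨hm, hd, hc, h0⟩
    refine ⟨hm, hd, fun i hi => (h1 _).2 (hc i hi), (h2 _).2 ?_⟩
    rw [hv.eq_of_dvd (hc 0 (by norm_num)) h0]
    norm_num

lemma rho_nine (i : ℕ) : S.rho f 9 α i = ramCoeff f α i := by
  simp only [rho, ramCoeff, Nat.cast_ofNat]

/-- The ramification polygon is a single segment exactly when `b = true`. -/
lemma hasDiscFifteen_true_iff (h0 : aeval α f = 0) :
    HasDiscFifteen true f ↔ S.IsEisensteinOfDegree f 9 ∧
      ((9 : ℚ) : WithTop ℚ) * S.v (aeval α (derivative f)) = ((15 : ℚ) : WithTop ℚ) ∧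
      ((9 : ℚ) : WithTop ℚ) * S.v (S.rho f 9 α 1) = ((7 : ℚ) : WithTop ℚ) ∧
      (∀ i : ℕ, 1 ≤ i → i ≤ 9 → ((((63 - 7 * (i : ℚ)) / 8 : ℚ)) : WithTop ℚ)
        ≤ ((9 : ℚ) : WithTop ℚ) * S.v (S.rho f 9 α i)) := by
  have hv := S.isNinePadic_nineVal
  simp only [← nineVal_apply, isEisensteinOfDegree_nine_iff, rho_nine]
  constructor
  · intro hf
    have hα := hf.val_root hv h0
    refine ⟨hf.toIsEisensteinNine, hf.val_derivative hv hα, hf.val_ramCoeff_one hv hα,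
      fun i h1 h9 => ?_⟩
    refine le_trans (WithTop.coe_le_coe.2 ?_) (hf.ramBound_le hv hα (Finset.mem_Icc.2 ⟨h1, h9⟩))
    interval_cases i <;> norm_num [ramBound]
  · rintro ⟨hf, h15, -, hbound⟩
    have hα := hf.val_root hv h0
    have hg := hf.hasDiscFifteen hv hα h15
    have hb := hg.eq_true_of_lt_val_ramCoeff_three hv hα
      ((WithTop.coe_lt_coe.2 (by norm_num)).trans_le (hbound 3 (by norm_num) (by norm_num)))
    rwa [hb] at hg

/-- The ramification polygon has a vertex at `(3, 3)` exactly when `b = false`. -/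
lemma hasDiscFifteen_false_iff (h0 : aeval α f = 0) :
    HasDiscFifteen false f ↔ S.IsEisensteinOfDegree f 9 ∧
      ((9 : ℚ) : WithTop ℚ) * S.v (aeval α (derivative f)) = ((15 : ℚ) : WithTop ℚ) ∧
      ((9 : ℚ) : WithTop ℚ) * S.v (S.rho f 9 α 1) = ((7 : ℚ) : WithTop ℚ) ∧
      ((9 : ℚ) : WithTop ℚ) * S.v (S.rho f 9 α 3) = ((3 : ℚ) : WithTop ℚ) ∧
      (∀ i : ℕ, 1 ≤ i → i ≤ 3 → (((9 - 2 * (i : ℚ) : ℚ)) : WithTop ℚ)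
        ≤ ((9 : ℚ) : WithTop ℚ) * S.v (S.rho f 9 α i)) ∧
      (∀ i : ℕ, 3 ≤ i → i ≤ 9 → ((((9 - (i : ℚ)) / 2 : ℚ)) : WithTop ℚ)
        ≤ ((9 : ℚ) : WithTop ℚ) * S.v (S.rho f 9 α i)) := by
  have hv := S.isNinePadic_nineVal
  simp only [← nineVal_apply, isEisensteinOfDegree_nine_iff, rho_nine]
  constructor
  · intro hf
    have hα := hf.val_root hv h0
    refine ⟨hf.toIsEisensteinNine, hf.val_derivative hv hα, hf.val_ramCoeff_one hv hα,
      hf.val_ramCoeff_three hv hα, fun i h1 h9 => ?_, fun i h1 h9 => ?_⟩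
    all_goals
      refine le_trans (WithTop.coe_le_coe.2 ?_)
        (hf.ramBound_le hv hα (Finset.mem_Icc.2 ⟨by omega, by omega⟩))
      interval_cases i <;> norm_num [ramBound]
  · rintro ⟨hf, h15, -, h3, -⟩
    have hα := hf.val_root hv h0
    have hg := hf.hasDiscFifteen hv hα h15
    generalize @decide (ThreePowDvd 2 (f.coeff 3)) (Classical.propDecidable _) = c at hg
    cases c
    · exact hg
    · have h6 := hg.le_val_ramCoeff_three_of_eq_true hv hα rfl
      rw [h3, WithTop.coe_le_coe] at h6
      norm_num at h6

end PadicSetup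

end PadicSetup

/-- Among the totally ramified extensions of `ℚ₃` of degree 9 with
discriminant `(3)^15` (i.e. `v_α(f'(α)) = 15` for an Eisenstein generator `f` with root
`α`), exactly 54 have ramification polygon with vertices `{(1,7), (9,0)}` (a single
segment: `v_α(ρ_1) = 7` and all points on or above the line through `(1,7)` and `(9,0)`),
and exactly 108 have ramification polygon with vertices `{(1,7), (3,3), (9,0)}`
(`v_α(ρ_1) = 7`, `v_α(ρ_3) = 3`, points above the corresponding two lines). -/
theorem count_degree_nine_extensions_of_Q3_by_ramification_polygon
    {Ω : Type*} [Field Ω] [Algebra ℚ_[3] Ω] [IsAlgClosed Ω] [Algebra.IsAlgebraic ℚ_[3] Ω]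
    (S : PadicSetup 3 ℚ_[3] Ω) :
    Nat.card {L : IntermediateField ℚ_[3] Ω // ∃ f : Polynomial ℚ_[3],
        S.IsEisensteinOfDegree f 9 ∧ ∃ α : Ω, aeval α f = 0 ∧
          L = IntermediateField.adjoin ℚ_[3] {α} ∧
          ((9 : ℚ) : WithTop ℚ) * S.v (aeval α (derivative f)) = ((15 : ℚ) : WithTop ℚ) ∧
          ((9 : ℚ) : WithTop ℚ) * S.v (S.rho f 9 α 1) = ((7 : ℚ) : WithTop ℚ) ∧
          (∀ i : ℕ, 1 ≤ i → i ≤ 9 →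
            ((((63 - 7 * (i : ℚ)) / 8 : ℚ)) : WithTop ℚ)
              ≤ ((9 : ℚ) : WithTop ℚ) * S.v (S.rho f 9 α i))} = 54
    ∧ Nat.card {L : IntermediateField ℚ_[3] Ω // ∃ f : Polynomial ℚ_[3],
        S.IsEisensteinOfDegree f 9 ∧ ∃ α : Ω, aeval α f = 0 ∧
          L = IntermediateField.adjoin ℚ_[3] {α} ∧
          ((9 : ℚ) : WithTop ℚ) * S.v (aeval α (derivative f)) = ((15 : ℚ) : WithTop ℚ) ∧
          ((9 : ℚ) : WithTop ℚ) * S.v (S.rho f 9 α 1) = ((7 : ℚ) : WithTop ℚ) ∧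
          ((9 : ℚ) : WithTop ℚ) * S.v (S.rho f 9 α 3) = ((3 : ℚ) : WithTop ℚ) ∧
          (∀ i : ℕ, 1 ≤ i → i ≤ 3 →
            (((9 - 2 * (i : ℚ) : ℚ)) : WithTop ℚ)
              ≤ ((9 : ℚ) : WithTop ℚ) * S.v (S.rho f 9 α i)) ∧
          (∀ i : ℕ, 3 ≤ i → i ≤ 9 →
            ((((9 - (i : ℚ)) / 2 : ℚ)) : WithTop ℚ)
              ≤ ((9 : ℚ) : WithTop ℚ) * S.v (S.rho f 9 α i))} = 108 := by
  have hv := S.isNinePadic_nineVal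
  have htrue := (two_mul_card_fields hv true).trans card_polyReps_true
  have hfalse := (two_mul_card_fields hv false).trans card_polyReps_false
  constructor
  · refine Eq.trans (Nat.card_congr (Equiv.subtypeEquivRight fun L => ?_))
      (by omega : _ = 54) (b := Nat.card {L : IntermediateField ℚ_[3] Ω // ∃ f : ℚ_[3][X], ∃ α : Ω,
        HasDiscFifteen true f ∧ aeval α f = 0 ∧ L = IntermediateField.adjoin ℚ_[3] {α}})
    constructor
    · rintro ⟨f, hf, α, h0, hL, h⟩
      exact ⟨f, α, (S.hasDiscFifteen_true_iff h0).2 ⟨hf, h⟩, h0, hL⟩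
    · rintro ⟨f, α, hf, h0, hL⟩
      have h := (S.hasDiscFifteen_true_iff h0).1 hf
      exact ⟨f, h.1, α, h0, hL, h.2⟩
  · refine Eq.trans (Nat.card_congr (Equiv.subtypeEquivRight fun L => ?_))
      (by omega : _ = 108) (b := Nat.card {L : IntermediateField ℚ_[3] Ω // ∃ f : ℚ_[3][X], ∃ α : Ω,
        HasDiscFifteen false f ∧ aeval α f = 0 ∧ L = IntermediateField.adjoin ℚ_[3] {α}})
    constructor
    · rintro ⟨f, hf, α, h0, hL, h⟩
      exact ⟨f, α, (S.hasDiscFifteen_false_iff h0).2 ⟨hf, h⟩, h0, hL⟩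
    · rintro ⟨f, α, hf, h0, hL⟩
      have h := (S.hasDiscFifteen_false_iff h0).1 hf
      exact ⟨f, h.1, α, h0, hL, h.2⟩
end
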